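/- arXiv:1506.06743 — 6 statements merged into one kernel-verified Lean document; each statement's English description precedes it below -/
import Mathlib

section
/- (Warning's Second Theorem) Let q be a prime power, and let f_1,...,f_r ∈ F_q[t_1,...,t_n] with d = Σ deg f_i < n. Let Z be the set of common zeros of f_1,...,f_r in F_q^n. Then #Z = 0 or #Z ≥ q^{n-d}. -/
open MvPolynomial

lemma aux_fiber (F : Type*) [Field F] [Fintype F] [DecidableEq F] (p : Polynomial F) (hp : p ≠ 0) :
    Fintype.card F - p.natDegree ≤ (Finset.univ.filter (fun a => p.eval a ≠ 0)).card := by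
  have h1 : (Finset.univ.filter (fun a => p.eval a = 0)).card ≤ p.natDegree := by
    refine le_trans (Finset.card_le_card ?_) (p.roots.toFinset_card_le.trans p.card_roots')
    intro a ha
    simpa [hp] using ha
  have h2 := Finset.card_filter_add_card_filter_not (s := (Finset.univ : Finset F))
    (fun a => p.eval a = 0)
  rw [Finset.card_univ] at h2
  have h3 : (Finset.univ.filter (fun a => p.eval a ≠ 0)).card
    = (Finset.univ.filter (fun a => ¬ p.eval a = 0)).card := rfl
  omega

lemma aux_nonzeros (F : Type*) [Field F] [Fintype F] [DecidableEq F] (n : ℕ) :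
    ∀ f : MvPolynomial (Fin n) F, f ≠ 0 →
    ∃ m ∈ f.support, ∏ i, (Fintype.card F - m i) ≤
      (Finset.univ.filter (fun x : Fin n → F => eval x f ≠ 0)).card := by
  induction n with
  | zero =>
    intro f hf
    obtain ⟨m, hm⟩ := MvPolynomial.support_nonempty.2 hf
    refine ⟨m, hm, ?_⟩
    simp only [Finset.univ_eq_empty, Finset.prod_empty]
    refine Finset.card_pos.2 ?_
    refine ⟨Fin.elim0, Finset.mem_filter.2 ⟨Finset.mem_univ _, ?_⟩⟩
    rw [MvPolynomial.eq_C_of_isEmpty f] at hf ⊢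
    simpa using hf
  | succ n ih =>
    intro f hf
    set P := finSuccEquiv F n f with hP
    have hP0 : P ≠ 0 := by simpa [hP] using hf
    have hl : P.coeff P.natDegree ≠ 0 := by simpa using hP0
    obtain ⟨m, hm, hle⟩ := ih _ hl
    refine ⟨m.cons P.natDegree, mem_support_coeff_finSuccEquiv.1 hm, ?_⟩
    rw [Fin.prod_univ_succ]
    simp only [Finsupp.cons_zero, Finsupp.cons_succ]
    set S := Finset.univ.filter (fun y : Fin n → F => eval y (P.coeff P.natDegree) ≠ 0) with hS
    have hmap : (S.sigma (fun y => Finset.univ.filter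
        (fun a : F => (P.map (eval y)).eval a ≠ 0))).card ≤
        (Finset.univ.filter (fun x : Fin (n+1) → F => eval x f ≠ 0)).card := by
      apply Finset.card_le_card_of_injOn (fun z => Fin.cons z.2 z.1)
      · rintro ⟨y, a⟩ h
        simp only [Finset.coe_sigma, Set.mem_sigma_iff, Finset.mem_coe, Finset.mem_filter,
          Finset.mem_univ, true_and] at h ⊢
        rw [eval_eq_eval_mv_eval']
        exact h.2
      · rintro ⟨y, a⟩ _ ⟨y', a'⟩ _ h
        have := Fin.cons_injective2 h
        obtain ⟨h1, h2⟩ := this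
        simp only at h1 h2
        subst h1 h2
        rfl
    refine le_trans ?_ hmap
    rw [Finset.card_sigma]
    calc _ ≤ (Fintype.card F - P.natDegree) * S.card := Nat.mul_le_mul_left _ hle
      _ = ∑ y ∈ S, (Fintype.card F - P.natDegree) := by rw [Finset.sum_const, smul_eq_mul, mul_comm]
      _ ≤ _ := by
        refine Finset.sum_le_sum fun y hy => ?_
        have hy' : eval y (P.coeff P.natDegree) ≠ 0 := (Finset.mem_filter.1 hy).2
        have hne : P.map (eval y) ≠ 0 := by
          intro h
          apply hy'
          have := congrArg (fun p => Polynomial.coeff p P.natDegree) h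
          simpa using this
        refine le_trans ?_ (aux_fiber F _ hne)
        exact Nat.sub_le_sub_left Polynomial.natDegree_map_le _

lemma aux_ineq (k Q : ℕ) (h : k ≤ Q) : (1 + Q) ^ k ≤ (1 + k) ^ Q := by
  rcases Nat.eq_zero_or_pos Q with rfl | hQ
  · have : k = 0 := by omega
    subst this; simp
  have hQ' : (0:ℝ) < Q := by exact_mod_cast hQ
  have key := rpow_one_add_le_one_add_mul_self (s := (Q:ℝ)) (by linarith) (p := (k:ℝ)/Q)
    (by positivity) (by rw [div_le_one hQ']; exact_mod_cast h)
  rw [div_mul_cancel₀ _ hQ'.ne'] at key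
  have k2 := pow_le_pow_left₀ (by positivity) key Q
  rw [← Real.rpow_natCast, ← Real.rpow_mul (by positivity), div_mul_cancel₀ _ hQ'.ne',
    Real.rpow_natCast] at k2
  exact_mod_cast k2

/-- Reduction of exponents modulo `x ^ q = x`. -/
def auxRed (q e : ℕ) : ℕ := if e = 0 then 0 else (e - 1) % (q - 1) + 1

lemma auxRed_le (q e : ℕ) : auxRed q e ≤ e := by
  unfold auxRed
  split_ifs with h
  · omega
  · have := Nat.mod_le (e-1) (q-1)
    omega

lemma auxRed_lt (q e : ℕ) (hq : 1 < q) : auxRed q e ≤ q - 1 := by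
  unfold auxRed
  split_ifs with h
  · omega
  · have := Nat.mod_lt (e-1) (show 0 < q-1 by omega)
    omega

lemma auxRed_pow (F : Type*) [Field F] [Fintype F] (a : F) (e : ℕ) :
    a ^ auxRed (Fintype.card F) e = a ^ e := by
  unfold auxRed
  split_ifs with h
  · rw [h]
  · by_cases ha : a = 0
    · subst ha
      rw [zero_pow (by omega), zero_pow h]
    · have h1 := FiniteField.pow_card_sub_one_eq_one a ha
      conv_rhs => rw [show e = (e - 1) + 1 by omega,
        ← Nat.div_add_mod (e-1) (Fintype.card F - 1)]
      rw [pow_succ, pow_succ, pow_add, pow_mul, h1, one_pow, one_mul]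

lemma aux_reduce (F : Type*) [Field F] [Fintype F] (n : ℕ) (f : MvPolynomial (Fin n) F) :
    ∃ g : MvPolynomial (Fin n) F, (∀ x, eval x g = eval x f) ∧
      ∀ m ∈ g.support, (∀ i, m i ≤ Fintype.card F - 1) ∧ ∑ i, m i ≤ f.totalDegree := by
  classical
  let R : (Fin n →₀ ℕ) → (Fin n →₀ ℕ) :=
    fun m => Finsupp.equivFunOnFinite.symm (fun i => auxRed (Fintype.card F) (m i))
  refine ⟨∑ m ∈ f.support, monomial (R m) (coeff m f), ?_, ?_⟩
  · intro x
    rw [map_sum, eval_eq' x f]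
    refine Finset.sum_congr rfl fun m _ => ?_
    rw [eval_monomial, Finsupp.prod_fintype _ _ (by simp)]
    simp [R, auxRed_pow]
  · intro m hm
    have := support_sum hm
    rw [Finset.mem_biUnion] at this
    obtain ⟨m', hm', h⟩ := this
    have h2 := support_monomial_subset h
    rw [Finset.mem_singleton] at h2
    subst h2
    refine ⟨fun i => auxRed_lt _ _ Fintype.one_lt_card, ?_⟩
    refine le_trans ?_ (le_totalDegree hm')
    rw [Finsupp.sum_fintype _ _ (by simp)]
    exact Finset.sum_le_sum fun i _ => auxRed_le _ _

theorem stmt4 (F : Type*) [Field F] [Fintype F] (n r : ℕ)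
    (f : Fin r → MvPolynomial (Fin n) F)
    (d : ℕ) (hd : d = ∑ i, (f i).totalDegree) (hdeg : d < n) :
    (({x : Fin n → F | ∀ i, eval x (f i) = 0}).ncard = 0) ∨
      Fintype.card F ^ (n - d) ≤ ({x : Fin n → F | ∀ i, eval x (f i) = 0}).ncard := by
  classical
  by_cases hZ : ∃ z : Fin n → F, ∀ i, eval z (f i) = 0
  swap
  · left
    push Not at hZ
    have : {x : Fin n → F | ∀ i, eval x (f i) = 0} = ∅ := by
      ext x
      simpa using hZ x
    rw [this, Set.ncard_empty]
  right
  obtain ⟨z, hz⟩ := hZ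
  obtain ⟨Q, hQ⟩ : ∃ Q, Fintype.card F = 1 + Q + 1 := by
    have := Fintype.one_lt_card (α := F)
    exact ⟨Fintype.card F - 2, by omega⟩
  set P : MvPolynomial (Fin n) F := ∏ i, (1 - f i ^ (Fintype.card F - 1)) with hP
  have hPdeg : P.totalDegree ≤ d * (Fintype.card F - 1) := by
    rw [hd, Finset.sum_mul]
    refine (totalDegree_finset_prod _ _).trans (Finset.sum_le_sum fun i _ => ?_)
    refine (totalDegree_sub _ _).trans ?_
    rw [totalDegree_one]
    refine max_le (Nat.zero_le _) ((totalDegree_pow _ _).trans ?_)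
    rw [mul_comm]
  have hPeval : ∀ x, eval x P ≠ 0 ↔ ∀ i, eval x (f i) = 0 := by
    intro x
    rw [hP, map_prod, Finset.prod_ne_zero_iff]
    refine ⟨fun h i => ?_, fun h i _ => ?_⟩
    · by_contra hne
      apply h i (Finset.mem_univ _)
      simp [FiniteField.pow_card_sub_one_eq_one _ hne]
    · simp [h i, hQ]
  obtain ⟨g, hg, hgm⟩ := aux_reduce F n P
  have hg0 : g ≠ 0 := by
    intro h
    apply (hPeval z).2 hz
    rw [← hg, h, map_zero]
  obtain ⟨m, hm, hle⟩ := aux_nonzeros F n g hg0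
  have hset : {x : Fin n → F | ∀ i, eval x (f i) = 0} =
      ↑(Finset.univ.filter (fun x : Fin n → F => eval x g ≠ 0)) := by
    ext x
    simp only [Set.mem_setOf_eq, Finset.coe_filter, Finset.mem_univ, true_and, hg]
    exact (hPeval x).symm
  rw [hset, Set.ncard_coe_finset]
  refine le_trans ?_ hle
  obtain ⟨hm1, hm2⟩ := hgm m hm
  have hm3 := hm2.trans hPdeg
  set q := Fintype.card F with hq
  refine le_of_pow_le_pow_left₀ (n := q - 1) (by omega) (Nat.zero_le _) ?_
  rw [← Finset.prod_pow, ← pow_mul]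
  have hsum : ∑ i, (q - 1 - m i) + ∑ i, m i = n * (q - 1) := by
    rw [← Finset.sum_add_distrib, Finset.sum_congr rfl fun i _ => Nat.sub_add_cancel (hm1 i)]
    simp
  calc q ^ ((n - d) * (q - 1)) ≤ q ^ (∑ i, (q - 1 - m i)) := by
        apply Nat.pow_le_pow_right (by omega)
        rw [Nat.sub_mul]
        omega
    _ = ∏ i, q ^ (q - 1 - m i) := (Finset.prod_pow_eq_pow_sum _ _ _).symm
    _ ≤ _ := by
        refine Finset.prod_le_prod' fun i _ => ?_
        have := aux_ineq (q - 1 - m i) (q - 1) (Nat.sub_le _ _)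
        have hi := hm1 i
        rwa [show 1 + (q - 1) = q by omega, show 1 + (q - 1 - m i) = q - m i by omega] at this
end

section
/- (Alon-Füredi over a ring) Let R be a commutative ring, and let A_1,...,A_n ⊂ R each satisfy Condition (D) (nonempty, finite, pairwise differences of distinct elements are non-zero-divisors). Let P ∈ R[t_1,...,t_n], and let U = {x ∈ A_1 × ... × A_n : P(x) ≠ 0}. Then #U = 0 or #U ≥ m(#A_1,...,#A_n; #A_1 + ... + #A_n - deg P). -/
open MvPolynomial

/-- `mBound n a N` : 1 if `N < n`, else the minimum of `∏ y i` over integer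
tuples with `1 ≤ y i ≤ a i` and `∑ y i = N`. -/
noncomputable def mBound (n : ℕ) (a : Fin n → ℕ) (N : ℕ) : ℕ :=
  if N < n then 1
  else sInf ((fun y : Fin n → ℕ => ∏ i, y i) ''
    {y | (∀ i, 1 ≤ y i ∧ y i ≤ a i) ∧ ∑ i, y i = N})

theorem af_decrease (n : ℕ) (N : ℕ) (hN : n ≤ N) : ∀ (k : ℕ) (y : Fin n → ℕ),
    (∀ i, 1 ≤ y i) → ∑ i, y i = N + k →
    ∃ z : Fin n → ℕ, (∀ i, 1 ≤ z i ∧ z i ≤ y i) ∧ ∑ i, z i = N := by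
  intro k
  induction k with
  | zero => intro y hy hs; exact ⟨y, fun i => ⟨hy i, le_rfl⟩, by simpa using hs⟩
  | succ k ih =>
    intro y hy hs
    have : ∃ i, 1 < y i := by
      by_contra! h
      have : ∑ i, y i ≤ ∑ i : Fin n, 1 := Finset.sum_le_sum (fun i _ => h i)
      simp at this
      omega
    obtain ⟨i, hi⟩ := this
    have hsum : ∑ j, Function.update y i (y i - 1) j = N + k := by
      rw [Finset.sum_update_of_mem (Finset.mem_univ i)]
      have := Finset.add_sum_erase Finset.univ y (Finset.mem_univ i)
      rw [Finset.sdiff_singleton_eq_erase]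
      omega
    obtain ⟨z, hz, hzs⟩ := ih (Function.update y i (y i - 1)) (by
      intro j
      by_cases hj : j = i
      · subst hj; simp; omega
      · simp [hj, hy j]) hsum
    refine ⟨z, fun j => ⟨(hz j).1, (hz j).2.trans ?_⟩, hzs⟩
    by_cases hj : j = i
    · subst hj; simp
    · simp [hj]

theorem af_degree_split {n : ℕ} (m : Fin (n+1) →₀ ℕ) :
    m.degree = m 0 + (Finsupp.tail m).degree := by
  simp [Finsupp.degree_eq_sum, Fin.sum_univ_succ, Finsupp.tail_apply]

theorem af_mono {R : Type*} [CommRing R] {n : ℕ} (a : R) (m : Fin (n+1) →₀ ℕ) (c : R) (d : ℕ)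
    (hm : m.degree ≤ d) :
    (∃ P' : MvPolynomial (Fin n) R, P'.totalDegree ≤ d ∧
      ∀ x', eval x' P' = eval (Fin.cons a x') (monomial m c)) ∧
    (∃ Q : MvPolynomial (Fin (n+1)) R, (d = 0 → Q = 0) ∧ Q.totalDegree ≤ d - 1 ∧
      ∀ x0 x', eval (Fin.cons x0 x') (monomial m c) - eval (Fin.cons a x') (monomial m c)
        = (x0 - a) * eval (Fin.cons x0 x') Q) := by
  have hs := af_degree_split m
  have hev : ∀ (x0 : R) (x' : Fin n → R), eval (Fin.cons x0 x') (monomial m c)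
      = x0 ^ (m 0) * eval x' (monomial (Finsupp.tail m) c) := by
    intro x0 x'
    simp only [eval_monomial, Finsupp.prod_pow, Fin.prod_univ_succ, Fin.cons_zero, Fin.cons_succ,
      Finsupp.tail_apply]
    ring
  have htd : (monomial (Finsupp.tail m) c).totalDegree ≤ (Finsupp.tail m).degree :=
    totalDegree_monomial_le _ _
  refine ⟨⟨C (a ^ m 0) * monomial (Finsupp.tail m) c, ?_, ?_⟩, ?_⟩
  · refine (totalDegree_mul _ _).trans ?_
    rw [totalDegree_C]
    omega
  · intro x'
    rw [hev]; simp
  · by_cases h0 : m 0 = 0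
    · refine ⟨0, fun _ => rfl, by simp, ?_⟩
      intro x0 x'
      rw [hev, hev, h0]; simp
    · refine ⟨rename Fin.succ (monomial (Finsupp.tail m) c) *
        ∑ j ∈ Finset.range (m 0), X 0 ^ j * C (a ^ (m 0 - 1 - j)), fun h => by omega, ?_, ?_⟩
      · refine (totalDegree_mul _ _).trans ?_
        have h1 := (totalDegree_rename_le (Fin.succ) (monomial (Finsupp.tail m) c))
        have h2 : (∑ j ∈ Finset.range (m 0), (X 0 : MvPolynomial (Fin (n+1)) R) ^ j *
            C (a ^ (m 0 - 1 - j))).totalDegree ≤ m 0 - 1 := by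
          apply totalDegree_finsetSum_le
          intro j hj
          refine (totalDegree_mul _ _).trans ?_
          rw [totalDegree_C]
          have h3 : ((X 0 : MvPolynomial (Fin (n+1)) R) ^ j).totalDegree ≤ j := by
            rw [X_pow_eq_monomial]
            refine (totalDegree_monomial_le _ _).trans ?_
            simp
          have := Finset.mem_range.1 hj
          omega
        omega
      · intro x0 x'
        rw [hev, hev, map_mul, eval_rename]
        have hc : (Fin.cons x0 x' : Fin (n+1) → R) ∘ Fin.succ = x' := by ext i; simp
        rw [hc]
        have hg := (Commute.all x0 a).mul_geom_sum₂ (m 0)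
        simp only [map_sum, map_mul, map_pow, eval_X, eval_C, Fin.cons_zero]
        linear_combination (-(eval x' (monomial (Finsupp.tail m) c))) * hg

theorem af_poly {R : Type*} [CommRing R] {n : ℕ} (a : R) (P : MvPolynomial (Fin (n+1)) R) (d : ℕ)
    (hP : P.totalDegree ≤ d) :
    (∃ P' : MvPolynomial (Fin n) R, P'.totalDegree ≤ d ∧
      ∀ x', eval x' P' = eval (Fin.cons a x') P) ∧
    (∃ Q : MvPolynomial (Fin (n+1)) R, (d = 0 → Q = 0) ∧ Q.totalDegree ≤ d - 1 ∧
      ∀ x0 x', eval (Fin.cons x0 x') P - eval (Fin.cons a x') P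
        = (x0 - a) * eval (Fin.cons x0 x') Q) := by
  have key := fun m : P.support => af_mono a m.1 (coeff m.1 P) d
    (by
      refine le_trans ?_ hP
      exact le_totalDegree m.2)
  choose h1 h2 using key
  choose f hf1 hf2 using h1
  choose g hg0 hg1 hg2 using h2
  have hPs : ∀ x, eval x P = ∑ m : P.support, eval x (monomial m.1 (coeff m.1 P)) := by
    intro x
    conv_lhs => rw [P.as_sum, map_sum]
    exact (Finset.sum_coe_sort P.support (fun m => eval x (monomial m (coeff m P)))).symm
  refine ⟨⟨∑ m, f m, totalDegree_finsetSum_le (fun m _ => hf1 m), ?_⟩,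
    ∑ m, g m, ?_, totalDegree_finsetSum_le (fun m _ => hg1 m), ?_⟩
  · intro x'
    rw [map_sum, hPs]
    exact Finset.sum_congr rfl fun m _ => hf2 m x'
  · intro h
    exact Finset.sum_eq_zero fun m _ => hg0 m h
  · intro x0 x'
    rw [hPs, hPs, map_sum, ← Finset.sum_sub_distrib, Finset.mul_sum]
    exact Finset.sum_congr rfl fun m _ => hg2 m x0 x'

open Classical in
theorem af_key {R : Type*} [CommRing R] (n : ℕ) : ∀ (A : Fin n → Finset R)
    (_ : ∀ i, ∀ x ∈ A i, ∀ y ∈ A i, x ≠ y → (x - y) ∈ nonZeroDivisors R)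
    (P : MvPolynomial (Fin n) R) (d : ℕ), P.totalDegree ≤ d →
    ((Fintype.piFinset A).filter (fun x => eval x P ≠ 0)).Nonempty →
    ∃ y : Fin n → ℕ, (∀ i, 1 ≤ y i ∧ y i ≤ (A i).card) ∧ ∑ i, (A i).card ≤ ∑ i, y i + d ∧
      ∏ i, y i ≤ ((Fintype.piFinset A).filter (fun x => eval x P ≠ 0)).card := by
  induction n with
  | zero =>
    intro A _ P d _ hne
    exact ⟨fun _ => 1, fun i => i.elim0, by simp, by simpa using hne.card_pos⟩
  | succ n ihn =>
    suffices H : ∀ (k : ℕ) (A : Fin (n+1) → Finset R), (A 0).card = k →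
        (∀ i, ∀ x ∈ A i, ∀ y ∈ A i, x ≠ y → (x - y) ∈ nonZeroDivisors R) →
        ∀ (P : MvPolynomial (Fin (n+1)) R) (d : ℕ), P.totalDegree ≤ d →
        ((Fintype.piFinset A).filter (fun x => eval x P ≠ 0)).Nonempty →
        ∃ y : Fin (n+1) → ℕ, (∀ i, 1 ≤ y i ∧ y i ≤ (A i).card) ∧
          ∑ i, (A i).card ≤ ∑ i, y i + d ∧
          ∏ i, y i ≤ ((Fintype.piFinset A).filter (fun x => eval x P ≠ 0)).card from
      fun A => H _ A rfl
    intro k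
    induction k with
    | zero =>
      intro A hk _ P d _ ⟨x, hx⟩
      simp only [Finset.mem_filter, Fintype.mem_piFinset] at hx
      have := hx.1 0
      rw [Finset.card_eq_zero.1 hk] at this
      simp at this
    | succ k ihk =>
      intro A hk hD P d hd hne
      by_cases hv : ∃ a ∈ A 0, ∀ x' : Fin n → R, (∀ i, x' i ∈ A i.succ) →
          eval (Fin.cons a x') P = 0
      · obtain ⟨a, ha, hv⟩ := hv
        obtain ⟨Q, hQ0, hQd, hQ⟩ := (af_poly a P d hd).2
        let A' : Fin (n+1) → Finset R := Fin.cons ((A 0).erase a) (fun i => A i.succ)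
        have hsub : ∀ i, A' i ⊆ A i := by
          intro i
          refine Fin.cases ?_ (fun j => ?_) i
          · simp [A', Finset.erase_subset]
          · simp [A']
        have hPQ : ∀ x : Fin (n+1) → R, (∀ i, x i ∈ A i) →
            eval x P = (x 0 - a) * eval x Q := by
          intro x hx
          have h1 := hQ (x 0) (Fin.tail x)
          rw [hv (Fin.tail x) (fun i => hx i.succ), Fin.cons_self_tail, sub_zero] at h1
          exact h1
        have hset : (Fintype.piFinset A).filter (fun x => eval x P ≠ 0)
            = (Fintype.piFinset A').filter (fun x => eval x Q ≠ 0) := by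
          ext x
          simp only [Finset.mem_filter, Fintype.mem_piFinset]
          constructor
          · rintro ⟨hx, hxP⟩
            rw [hPQ x hx] at hxP
            refine ⟨fun i => ?_, fun h => hxP (by rw [h, mul_zero])⟩
            refine Fin.cases ?_ (fun j => ?_) i
            · simp only [A', Fin.cons_zero, Finset.mem_erase]
              exact ⟨fun h => hxP (by rw [h, sub_self, zero_mul]), hx 0⟩
            · simpa [A'] using hx j.succ
          · rintro ⟨hx, hxQ⟩
            have hx' : ∀ i, x i ∈ A i := fun i => hsub i (hx i)
            refine ⟨hx', fun h => hxQ ?_⟩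
            rw [hPQ x hx', mul_comm] at h
            have h0 := hx 0
            simp only [A', Fin.cons_zero, Finset.mem_erase] at h0
            exact (mul_right_mem_nonZeroDivisors_eq_zero_iff
              (hD 0 _ h0.2 _ ha h0.1)).1 h
        rw [hset] at hne ⊢
        have hdpos : d ≠ 0 := by
          intro h
          obtain ⟨x, hx⟩ := hne
          simp [hQ0 h] at hx
        obtain ⟨y, hy, hys, hyp⟩ := ihk A'
          (by simp [A', Finset.card_erase_of_mem ha, hk])
          (fun i x hx y hy => hD i x (hsub i hx) y (hsub i hy)) Q (d - 1) hQd hne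
        refine ⟨y, fun i => ⟨(hy i).1, (hy i).2.trans (Finset.card_le_card (hsub i))⟩, ?_, hyp⟩
        rw [Fin.sum_univ_succ] at hys ⊢
        simp only [A', Fin.cons_zero, Fin.cons_succ, Finset.card_erase_of_mem ha] at hys
        omega
      · push Not at hv
        have step : ∀ a ∈ A 0, ∃ y : Fin n → ℕ, (∀ i, 1 ≤ y i ∧ y i ≤ (A i.succ).card) ∧
            ∑ i : Fin n, (A i.succ).card ≤ ∑ i, y i + d ∧
            ∏ i, y i ≤ (((Fintype.piFinset A).filter (fun x => eval x P ≠ 0)).filter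
              (fun x => x 0 = a)).card := by
          intro a ha
          obtain ⟨P', hP'd, hP'⟩ := (af_poly a P d hd).1
          obtain ⟨x', hx', hxP⟩ := hv a ha
          obtain ⟨y, hy, hys, hyp⟩ := ihn (fun i => A i.succ) (fun i => hD i.succ) P' d hP'd
            ⟨x', by simp only [Finset.mem_filter, Fintype.mem_piFinset]
                    exact ⟨hx', by rwa [hP']⟩⟩
          refine ⟨y, hy, hys, hyp.trans ?_⟩
          apply Finset.card_le_card_of_injOn (fun x => (Fin.cons a x : Fin (n+1) → R))
          · intro x hx
            simp only [Finset.coe_filter, Set.mem_ofPred_eq, Fintype.mem_piFinset,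
              Finset.mem_filter] at hx ⊢
            refine ⟨⟨fun i => ?_, by rw [← hP']; exact hx.2⟩, by simp⟩
            refine Fin.cases ?_ (fun j => ?_) i
            · simpa using ha
            · simpa using hx.1 j
          · intro x _ z _ h
            exact Fin.cons_right_injective (α := fun _ => R) a h
        choose! f hf1 hf2 hf3 using step
        have hB : (A 0).Nonempty := Finset.card_pos.1 (by omega)
        obtain ⟨b, hb, hmin⟩ := Finset.exists_min_image (A 0) (fun a => ∏ i, f a i) hB
        refine ⟨Fin.cons (A 0).card (f b), fun i => ?_, ?_, ?_⟩
        · refine Fin.cases ?_ (fun j => ?_) i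
          · simpa using hB
          · simpa using hf1 b hb j
        · rw [Fin.sum_univ_succ, Fin.sum_univ_succ]
          simp only [Fin.cons_zero, Fin.cons_succ]
          have := hf2 b hb
          omega
        · rw [Fin.prod_univ_succ]
          simp only [Fin.cons_zero, Fin.cons_succ]
          rw [Finset.card_eq_sum_card_fiberwise (f := fun x : Fin (n+1) → R => x 0) (t := A 0)]
          · rw [← smul_eq_mul]
            apply Finset.card_nsmul_le_sum
            intro a ha
            exact (hmin a ha).trans (hf3 a ha)
          · intro x hx
            simp only [Finset.coe_filter, Set.mem_ofPred_eq, Fintype.mem_piFinset] at hx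
            exact hx.1 0

theorem stmt10 (R : Type*) [CommRing R] (n : ℕ)
    (A : Fin n → Finset R) (hA : ∀ i, (A i).Nonempty)
    (hD : ∀ i, ∀ x ∈ A i, ∀ y ∈ A i, x ≠ y → (x - y) ∈ nonZeroDivisors R)
    (P : MvPolynomial (Fin n) R)
    (U : Set (Fin n → R))
    (hU : U = {x | (∀ i, x i ∈ A i) ∧ eval x P ≠ 0}) :
    U.ncard = 0 ∨
      mBound n (fun i => (A i).card)
        ((∑ i, (A i).card) - P.totalDegree) ≤ U.ncard := by
  classical
  have hUF : U = (((Fintype.piFinset A).filter (fun x => eval x P ≠ 0) :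
      Finset (Fin n → R)) : Set (Fin n → R)) := by
    rw [hU]; ext x; simp [Fintype.mem_piFinset]
  rw [hUF, Set.ncard_coe_finset]
  by_cases hne : ((Fintype.piFinset A).filter (fun x => eval x P ≠ 0)).Nonempty
  · right
    unfold mBound
    split_ifs with h
    · exact hne.card_pos
    · obtain ⟨y, hy, hys, hyp⟩ := af_key n A hD P _ le_rfl hne
      obtain ⟨z, hz, hzs⟩ := af_decrease n _ (not_lt.1 h)
        (∑ i, y i - (∑ i, (A i).card - P.totalDegree)) y (fun i => (hy i).1) (by omega)
      refine le_trans (Nat.sInf_le ⟨z, ⟨fun i => ⟨(hz i).1, (hz i).2.trans (hy i).2⟩, hzs⟩, rfl⟩) ?_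
      exact (Finset.prod_le_prod' (fun i _ => (hz i).2)).trans hyp
  · left
    rw [Finset.not_nonempty_iff_eq_empty.1 hne]; simp
end

section
/- (Main Theorem over Dedekind domains) Let R be a Dedekind domain with a maximal ideal p such that R/p ≅ F_q is finite. Let n, r, v_1,...,v_r be positive integers, let A_1,...,A_n, B_1,...,B_r ⊂ R be nonempty finite subsets, each having no two distinct elements congruent modulo p, and let f_1,...,f_r ∈ R[t_1,...,t_n]. Let Z = {x ∈ A_1 × ... × A_n : for each j, there exists b ∈ B_j with f_j(x) ≡ b (mod p^{v_j})}. Then #Z = 0 or #Z ≥ m(#A_1,...,#A_n; Σ_i #A_i - Σ_j (q^{v_j} - #B_j)·deg f_j). -/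
open MvPolynomial

lemma af_div {R : Type*} [CommRing R] {n : ℕ} (i : Fin n) (α : R) (F : MvPolynomial (Fin n) R) :
    ∃ H : MvPolynomial (Fin n) R, (∀ x : Fin n → R,
      eval x F - eval (Function.update x i α) F = (x i - α) * eval x H) ∧
      (H = 0 ∨ H.totalDegree + 1 ≤ F.totalDegree) := by
  classical
  have key : ∀ s ∈ F.support, ∃ H : MvPolynomial (Fin n) R, (∀ x : Fin n → R,
      eval x (monomial s (coeff s F)) - eval (Function.update x i α) (monomial s (coeff s F))
        = (x i - α) * eval x H) ∧ (H = 0 ∨ H.totalDegree + 1 ≤ F.totalDegree) := by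
    intro s hs
    have hdeg := le_totalDegree hs
    have hsum : (s.sum fun _ e => e) = (s.erase i).sum (fun _ e => e) + s i := by
      rw [Finsupp.sum_fintype _ _ (by simp), Finsupp.sum_fintype _ _ (by simp),
        ← Finset.add_sum_erase _ (fun j => s j) (Finset.mem_univ i),
        ← Finset.add_sum_erase _ (fun j => (s.erase i) j) (Finset.mem_univ i)]
      simp only [Finsupp.erase_same]
      rw [Finset.sum_congr rfl (s₁ := Finset.univ.erase i) (f := fun j => (s.erase i) j)
        (g := fun j => s j) (fun j hj => by
        rw [Finsupp.erase_ne (Finset.ne_of_mem_erase hj)])]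
      ring
    refine ⟨monomial (s.erase i) (coeff s F) *
      ∑ k ∈ Finset.range (s i), X i ^ k * C α ^ (s i - 1 - k), ?_, ?_⟩
    · intro x
      have hm : ∀ z : Fin n → R, eval z (monomial s (coeff s F)) =
          eval z (monomial (s.erase i) (coeff s F)) * z i ^ s i := by
        intro z
        simp only [eval_monomial]
        rw [Finsupp.prod_fintype _ _ (by simp), Finsupp.prod_fintype _ _ (by simp),
          ← Finset.mul_prod_erase _ (fun j => z j ^ s j) (Finset.mem_univ i),
          ← Finset.mul_prod_erase _ (fun j => z j ^ (s.erase i) j) (Finset.mem_univ i)]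
        simp only [Finsupp.erase_same]
        rw [Finset.prod_congr rfl (s₁ := Finset.univ.erase i) (f := fun j => z j ^ (s.erase i) j)
          (g := fun j => z j ^ s j) (fun j hj => by
          rw [Finsupp.erase_ne (Finset.ne_of_mem_erase hj)])]
        ring
      have hu : eval (Function.update x i α) (monomial (s.erase i) (coeff s F)) =
          eval x (monomial (s.erase i) (coeff s F)) := by
        simp only [eval_monomial]
        congr 1
        refine Finset.prod_congr rfl fun j hj => ?_
        have : j ≠ i := by rintro rfl; simp at hj
        simp [Function.update_of_ne this]
      rw [hm, hm, hu]
      simp only [Function.update_self, map_mul, map_sum, map_pow, eval_X, eval_C]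
      rw [← mul_sub, ← (Commute.all (x i) α).mul_geom_sum₂]
      ring
    · rcases Nat.eq_zero_or_pos (s i) with h0 | h0
      · left; simp [h0]
      · right
        have h1 : (monomial (s.erase i) (coeff s F)).totalDegree ≤ (s.erase i).sum fun _ e => e :=
          totalDegree_monomial_le _ _
        have h2 : (∑ k ∈ Finset.range (s i), (X i ^ k * C α ^ (s i - 1 - k) :
            MvPolynomial (Fin n) R)).totalDegree ≤ s i - 1 := by
          refine totalDegree_finsetSum_le fun k hk => ?_
          rw [← map_pow]
          refine (totalDegree_mul _ _).trans ?_
          rw [totalDegree_C]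
          have : (X i ^ k : MvPolynomial (Fin n) R).totalDegree ≤ k := by
            rw [X_pow_eq_monomial]
            refine (totalDegree_monomial_le _ _).trans ?_
            simp
          have := Finset.mem_range.1 hk
          omega
        have := totalDegree_mul (monomial (s.erase i) (coeff s F))
          (∑ k ∈ Finset.range (s i), (X i ^ k * C α ^ (s i - 1 - k) : MvPolynomial (Fin n) R))
        omega
  choose! H hH hd using key
  refine ⟨∑ s ∈ F.support, H s, ?_, ?_⟩
  · intro x
    conv_lhs => rw [F.as_sum]
    simp only [map_sum]
    rw [← Finset.sum_sub_distrib, Finset.mul_sum]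
    exact Finset.sum_congr rfl fun s hs => hH s hs x
  · by_cases h : ∀ s ∈ F.support, H s = 0
    · left; exact Finset.sum_eq_zero h
    · right
      push Not at h
      obtain ⟨s, hs, h0⟩ := h
      have h1 := (hd s hs).resolve_left h0
      have : (∑ s ∈ F.support, H s).totalDegree ≤ F.totalDegree - 1 := by
        refine totalDegree_finsetSum_le fun s hs => ?_
        rcases hd s hs with h | h
        · simp [h]
        · omega
      omega

lemma af_peel {R : Type*} [CommRing R] (J : Ideal R) {n : ℕ} (A : Fin n → Finset R)
    (hA : ∀ i, ∀ x ∈ A i, ∀ y ∈ A i, x ≠ y → ∀ z, (x - y) * z ∈ J → z ∈ J)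
    (i : Fin n) (F : MvPolynomial (Fin n) R) (V : Finset R) (hV : V ⊆ A i)
    (hF : ∀ x : Fin n → R, (∀ j, x j ∈ A j) → x i ∈ V → eval x F ∈ J) :
    ∃ H : MvPolynomial (Fin n) R, (∀ x : Fin n → R, (∀ j, x j ∈ A j) →
      eval x F - (∏ α ∈ V, (x i - α)) * eval x H ∈ J) ∧
      (H = 0 ∨ H.totalDegree + V.card ≤ F.totalDegree) := by
  classical
  induction V using Finset.induction_on with
  | empty => exact ⟨F, by simp, by simp⟩
  | insert α V hα ih =>
    obtain ⟨H, hH, hd⟩ := ih ((Finset.subset_insert _ _).trans hV)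
      (fun x hx hi => hF x hx (Finset.mem_insert_of_mem hi))
    have hαA : α ∈ A i := hV (Finset.mem_insert_self _ _)
    obtain ⟨G, hG, hdG⟩ := af_div i α H
    refine ⟨G, ?_, ?_⟩
    · intro x hx
      have hx' : ∀ j, Function.update x i α j ∈ A j := by
        intro j
        by_cases h : j = i
        · subst h; simpa using hαA
        · simpa [Function.update_of_ne h] using hx j
      have h1 := hH _ hx'
      have h2 := hF _ hx' (by simp)
      have h3 : (∏ β ∈ V, (α - β)) * eval (Function.update x i α) H ∈ J := by
        have := J.sub_mem h2 h1
        simpa using this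
      have h4 : eval (Function.update x i α) H ∈ J := by
        have : ∀ U ⊆ V, ∀ z, (∏ β ∈ U, (α - β)) * z ∈ J → z ∈ J := by
          intro U
          induction U using Finset.induction_on with
          | empty => intro _ z hz; simpa using hz
          | insert β U hβ ih2 =>
            intro hU z hz
            rw [Finset.prod_insert hβ, mul_assoc] at hz
            have hβV : β ∈ V := hU (Finset.mem_insert_self _ _)
            refine ih2 ((Finset.subset_insert _ _).trans hU) z (hA i α hαA β
              (hV (Finset.mem_insert_of_mem hβV)) ?_ _ hz)
            rintro rfl; exact hα hβV
        exact this V subset_rfl _ h3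
      rw [Finset.prod_insert hα]
      have h5 := J.add_mem (hH x hx) (J.mul_mem_left (∏ β ∈ V, (x i - β)) h4)
      have : eval x H = eval (Function.update x i α) H + (x i - α) * eval x G := by
        rw [← hG]; ring
      rw [this] at h5
      convert h5 using 1
      ring
    · rw [Finset.card_insert_of_notMem hα]
      rcases hdG with h | h
      · left; exact h
      · rcases hd with h' | h'
        · subst h'; simp at h
        · right; omega

open Classical in
lemma af_main {R : Type*} [CommRing R] (J : Ideal R) {n : ℕ} : ∀ (m : ℕ) (A : Fin n → Finset R)
    (_ : ∀ i, (A i).Nonempty) (_ : ∑ i, (A i).card = m)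
    (_ : ∀ i, ∀ x ∈ A i, ∀ y ∈ A i, x ≠ y → ∀ z, (x - y) * z ∈ J → z ∈ J)
    (F : MvPolynomial (Fin n) R)
    (_ : ∃ x ∈ Fintype.piFinset A, eval x F ∉ J),
    ∃ y : Fin n → ℕ, (∀ i, 1 ≤ y i ∧ y i ≤ (A i).card) ∧
      ∑ i, (A i).card ≤ ∑ i, y i + F.totalDegree ∧
      ∏ i, y i ≤ ((Fintype.piFinset A).filter (fun x => eval x F ∉ J)).card := by
  intro m
  induction m using Nat.strong_induction_on with
  | _ m IH =>
  intro A hne hm hA F hF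
  by_cases hs : ∀ i, (A i).card = 1
  · refine ⟨fun _ => 1, fun i => by simp [hs], by simp [hs], ?_⟩
    simp only [Finset.prod_const_one]
    obtain ⟨x, hx, hxF⟩ := hF
    exact Finset.card_pos.2 ⟨x, by simp only [Finset.mem_filter]; exact ⟨hx, hxF⟩⟩
  push Not at hs
  obtain ⟨i, hi⟩ := hs
  have hi2 : 2 ≤ (A i).card := by
    have := (hne i).card_pos
    omega
  set V := (A i).filter (fun α => ∀ x ∈ Fintype.piFinset A, x i = α → eval x F ∈ J) with hVdef
  have hVA : V ⊆ A i := Finset.filter_subset _ _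
  obtain ⟨H, hH, hd⟩ := af_peel J A hA i F V hVA (by
    intro x hx hxi
    exact (Finset.mem_filter.1 hxi).2 x (Fintype.mem_piFinset.2 hx) rfl)
  set U := A i \ V with hU
  have hUcard : U.card + V.card = (A i).card := Finset.card_sdiff_add_card_eq_card hVA
  have hprod : ∀ β ∈ U, ∀ z, (∏ α ∈ V, (β - α)) * z ∈ J → z ∈ J := by
    intro β hβ
    rw [hU, Finset.mem_sdiff] at hβ
    have : ∀ T ⊆ V, ∀ z, (∏ α ∈ T, (β - α)) * z ∈ J → z ∈ J := by
      intro T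
      induction T using Finset.induction_on with
      | empty => intro _ z hz; simpa using hz
      | insert α T hα ih2 =>
        intro hT z hz
        rw [Finset.prod_insert hα, mul_assoc] at hz
        have hαV : α ∈ V := hT (Finset.mem_insert_self _ _)
        refine ih2 ((Finset.subset_insert _ _).trans hT) z (hA i β hβ.1 α
          (hVA hαV) ?_ _ hz)
        rintro rfl; exact hβ.2 hαV
    exact this V subset_rfl
  have hiff : ∀ x ∈ Fintype.piFinset A, x i ∈ U → (eval x F ∉ J ↔ eval x H ∉ J) := by
    intro x hx hxi
    have h1 := hH x (Fintype.mem_piFinset.1 hx)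
    rw [not_iff_not]
    constructor
    · intro h
      apply hprod _ hxi
      have := J.sub_mem h h1
      simpa using this
    · intro h
      have := J.add_mem h1 (J.mul_mem_left (∏ α ∈ V, (x i - α)) h)
      simpa using this
  have hUex : ∀ β ∈ U, ∃ x ∈ Fintype.piFinset A, x i = β ∧ eval x F ∉ J := by
    intro β hβ
    rw [hU, Finset.mem_sdiff, hVdef, Finset.mem_filter] at hβ
    have := hβ.2
    push Not at this
    exact this hβ.1
  have hUne : U.Nonempty := by
    obtain ⟨x, hx, hxF⟩ := hF
    refine ⟨x i, Finset.mem_sdiff.2 ⟨Fintype.mem_piFinset.1 hx i, fun h => ?_⟩⟩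
    exact hxF ((Finset.mem_filter.1 h).2 x hx rfl)
  let cnt : R → Finset (Fin n → R) := fun β =>
    (Fintype.piFinset A).filter (fun x => eval x F ∉ J ∧ x i = β)
  obtain ⟨β, hβ, hmin⟩ := Finset.exists_min_image U (fun β => (cnt β).card) hUne
  have hβA : β ∈ A i := (Finset.mem_sdiff.1 hβ).1
  set A' := Function.update A i {β} with hA'
  have hA'sub : ∀ j, A' j ⊆ A j := by
    intro j
    by_cases h : j = i
    · subst h; simpa [hA'] using hβA
    · simp [hA', Function.update_of_ne h]
  have hsumA' : ∑ j, (A' j).card + (A i).card = ∑ j, (A j).card + 1 := by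
    rw [← Finset.add_sum_erase _ (fun j => (A' j).card) (Finset.mem_univ i),
      ← Finset.add_sum_erase _ (fun j => (A j).card) (Finset.mem_univ i)]
    rw [Finset.sum_congr rfl (s₁ := Finset.univ.erase i) (f := fun j => (A' j).card)
      (g := fun j => (A j).card) (fun j hj => by
        rw [hA', Function.update_of_ne (Finset.ne_of_mem_erase hj)])]
    simp [hA']
    omega
  have hmem' : ∀ x, x ∈ Fintype.piFinset A' ↔ x ∈ Fintype.piFinset A ∧ x i = β := by
    intro x
    simp only [Fintype.mem_piFinset]
    constructor
    · intro h
      exact ⟨fun j => hA'sub j (h j), by simpa [hA'] using h i⟩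
    · rintro ⟨h, rfl⟩ j
      by_cases hj : j = i
      · subst hj; simp [hA']
      · simpa [hA', Function.update_of_ne hj] using h j
  have hcnt : (Fintype.piFinset A').filter (fun x => eval x H ∉ J) = cnt β := by
    ext x
    simp only [cnt, Finset.mem_filter, hmem']
    constructor
    · rintro ⟨⟨h1, h2⟩, h3⟩
      exact ⟨h1, (hiff x h1 (h2 ▸ hβ)).2 h3, h2⟩
    · rintro ⟨h1, h3, h2⟩
      exact ⟨⟨h1, h2⟩, (hiff x h1 (h2 ▸ hβ)).1 h3⟩
  have hex : ∃ x ∈ Fintype.piFinset A', eval x H ∉ J := by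
    obtain ⟨x, hx, hxi, hxF⟩ := hUex β hβ
    exact ⟨x, (hmem' x).2 ⟨hx, hxi⟩, (hiff x hx (hxi ▸ hβ)).1 hxF⟩
  obtain ⟨y, hy1, hy2, hy3⟩ := IH (∑ j, (A' j).card) (by omega) A' (by
      intro j
      by_cases h : j = i
      · subst h; simp [hA']
      · simpa [hA', Function.update_of_ne h] using hne j) rfl
    (fun j x hx y hy => hA j x (hA'sub j hx) y (hA'sub j hy)) H hex
  have hd' : H.totalDegree + V.card ≤ F.totalDegree := by
    refine hd.resolve_left ?_
    rintro rfl
    obtain ⟨x, _, hx⟩ := hex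
    simp at hx
  have hyi : y i = 1 := by
    have := hy1 i
    simp [hA'] at this
    omega
  refine ⟨Function.update y i U.card, ?_, ?_, ?_⟩
  · intro j
    by_cases h : j = i
    · subst h
      simp only [Function.update_self]
      exact ⟨hUne.card_pos, by omega⟩
    · have := hy1 j
      simpa [hA', Function.update_of_ne h] using this
  · have : ∑ j, Function.update y i U.card j + 1 = ∑ j, y j + U.card := by
      rw [Finset.sum_update_of_mem (Finset.mem_univ i),
        ← Finset.add_sum_erase _ _ (Finset.mem_univ i), hyi, Finset.sdiff_singleton_eq_erase]
      omega
    omega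
  · have h1 : ∏ j, Function.update y i U.card j = U.card * ∏ j, y j := by
      rw [Finset.prod_update_of_mem (Finset.mem_univ i),
        ← Finset.mul_prod_erase Finset.univ y (Finset.mem_univ i), hyi,
        Finset.sdiff_singleton_eq_erase, one_mul]
    rw [h1]
    rw [hcnt] at hy3
    calc U.card * ∏ j, y j ≤ U.card * (cnt β).card := Nat.mul_le_mul_left _ hy3
      _ = ∑ _γ ∈ U, (cnt β).card := by simp
      _ ≤ ∑ γ ∈ U, (cnt γ).card := Finset.sum_le_sum hmin
      _ = (U.biUnion cnt).card := by
        rw [Finset.card_biUnion]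
        intro a _ b _ hab
        rw [Function.onFun, Finset.disjoint_left]
        intro x hx hx'
        simp only [cnt, Finset.mem_filter] at hx hx'
        exact hab (hx.2.2.symm.trans hx'.2.2)
      _ ≤ _ := by
        apply Finset.card_le_card
        intro x hx
        simp only [cnt, Finset.mem_biUnion, Finset.mem_filter] at hx ⊢
        obtain ⟨a, _, h, h', _⟩ := hx
        exact ⟨h, h'⟩

lemma exists_lower {n : ℕ} (N : ℕ) (hN : n ≤ N) : ∀ (m : ℕ) (y : Fin n → ℕ), (∀ i, 1 ≤ y i) →
    ∑ i, y i = N + m → ∃ z : Fin n → ℕ, (∀ i, 1 ≤ z i ∧ z i ≤ y i) ∧ ∑ i, z i = N := by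
  intro m
  induction m with
  | zero => intro y hy h; exact ⟨y, fun i => ⟨hy i, le_rfl⟩, h⟩
  | succ m ih =>
    intro y hy h
    obtain ⟨i, hi⟩ : ∃ i, 2 ≤ y i := by
      by_contra hcon
      push Not at hcon
      have : ∑ i, y i ≤ ∑ _i : Fin n, 1 := Finset.sum_le_sum fun i _ => by have := hcon i; omega
      simp at this
      omega
    obtain ⟨z, hz, hzs⟩ := ih (Function.update y i (y i - 1)) (by
      intro j
      by_cases hj : j = i
      · subst hj; simp; omega
      · simpa [Function.update_of_ne hj] using hy j) (by
      rw [Finset.sum_update_of_mem (Finset.mem_univ i), Finset.sdiff_singleton_eq_erase]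
      rw [← Finset.add_sum_erase _ _ (Finset.mem_univ i)] at h
      omega)
    refine ⟨z, fun j => ⟨(hz j).1, (hz j).2.trans ?_⟩, hzs⟩
    by_cases hj : j = i
    · subst hj; simp
    · simp [Function.update_of_ne hj]

/-- the order of `x` at `p` -/
noncomputable def ordAt {R : Type*} [CommRing R] (p : Ideal R) (x : R) : ℕ∞ :=
  emultiplicity p (Ideal.span {x})

section
variable {R : Type*} [CommRing R] [IsDedekindDomain R] (p : Ideal R)

lemma le_ordAt (x : R) (k : ℕ) : (k : ℕ∞) ≤ ordAt p x ↔ x ∈ p ^ k := by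
  rw [ordAt, ← pow_dvd_iff_le_emultiplicity, Ideal.dvd_span_singleton]

lemma ordAt_one (hp : p.IsMaximal) : ordAt p 1 = 0 := by
  by_contra h
  have : ((1 : ℕ) : ℕ∞) ≤ ordAt p 1 := by
    simpa using Order.one_le_iff_ne_zero.2 h
  rw [le_ordAt, pow_one] at this
  exact hp.ne_top ((Ideal.eq_top_iff_one _).2 this)

lemma ordAt_mul (hp : p.IsMaximal) (x y : R) : ordAt p (x * y) = ordAt p x + ordAt p y := by
  unfold ordAt
  rw [← Ideal.span_singleton_mul_span_singleton]
  by_cases h : p = ⊥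
  · subst h
    by_cases hx : x = 0
    · subst hx; simp
    by_cases hy : y = 0
    · subst hy; simp
    have hb : (⊥ : Ideal R) = 0 := rfl
    rw [hb, emultiplicity_zero_eq_zero_of_ne_zero, emultiplicity_zero_eq_zero_of_ne_zero,
      emultiplicity_zero_eq_zero_of_ne_zero, add_zero]
    all_goals simp [hx, hy]
  · exact emultiplicity_mul (Ideal.prime_of_isPrime h hp.isPrime)

lemma ordAt_prod (hp : p.IsMaximal) {ι : Type*} (s : Finset ι) (g : ι → R) :
    ordAt p (∏ i ∈ s, g i) = ∑ i ∈ s, ordAt p (g i) := by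
  classical
  induction s using Finset.induction_on with
  | empty => simpa using ordAt_one p hp
  | insert a s ha ih => rw [Finset.prod_insert ha, Finset.sum_insert ha, ordAt_mul p hp, ih]

lemma ordAt_congr {x y : R} {v : ℕ} (h : x - y ∈ p ^ v) (hx : x ∉ p ^ v) :
    ordAt p x = ordAt p y := by
  have hy : y ∉ p ^ v := fun hy => hx (by simpa using (p ^ v).add_mem h hy)
  refine ENat.eq_of_forall_natCast_le_iff fun k => ?_
  rw [le_ordAt, le_ordAt]
  rcases le_total k v with hk | hk
  · have h' := Ideal.pow_le_pow_right hk h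
    constructor
    · intro hx; simpa using (p ^ k).sub_mem hx h'
    · intro hy; simpa using (p ^ k).add_mem h' hy
  · exact ⟨fun h => absurd (Ideal.pow_le_pow_right hk h) hx,
      fun h => absurd (Ideal.pow_le_pow_right hk h) hy⟩

lemma card_quot_pow_le (hp : p.IsMaximal) [Fintype (R ⧸ p)] (v : ℕ) (hv : 1 ≤ v) :
    Nat.card (R ⧸ p ^ v) ≤ Fintype.card (R ⧸ p) ^ v := by
  by_cases h : p = ⊥
  · have : p ^ v = p := by
      subst h
      have hb : (⊥ : Ideal R) = 0 := rfl
      rw [hb, zero_pow (by omega)]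
    rw [this, Nat.card_eq_fintype_card]
    exact Nat.le_self_pow (by omega) _
  · have := hp.isPrime
    have := cardQuot_pow_of_prime (P := p) h (i := v)
    rw [Submodule.cardQuot_apply, Submodule.cardQuot_apply] at this
    rw [← Nat.card_eq_fintype_card]
    exact this.le

lemma sep_poly (hp : p.IsMaximal) [Fintype (R ⧸ p)] (v : ℕ) (hv : 1 ≤ v) (B : Finset R)
    (hBp : ∀ x ∈ B, ∀ y ∈ B, x ≠ y → x - y ∉ p) :
    ∃ (T : Finset R) (w : ℕ), T.card ≤ Fintype.card (R ⧸ p) ^ v - B.card ∧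
      ∀ g : R, ((∃ b ∈ B, g - b ∈ p ^ v) → ordAt p (∏ c ∈ T, (g - c)) = w) ∧
        ((¬ ∃ b ∈ B, g - b ∈ p ^ v) → (w : ℕ∞) < ordAt p (∏ c ∈ T, (g - c))) := by
  classical
  have hpv : p ^ v ≤ p := Ideal.pow_le_self (by omega)
  have : Finite (R ⧸ p ^ v) := Ideal.finite_quotient_pow (IsNoetherian.noetherian p) v
  have : Fintype (R ⧸ p ^ v) := Fintype.ofFinite _
  let mk := Ideal.Quotient.mk (p ^ v)
  let out : R ⧸ p ^ v → R := Function.surjInv Ideal.Quotient.mk_surjective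
  have hout : ∀ d, mk (out d) = d := Function.surjInv_eq _
  have hmk : ∀ x y, mk x = mk y ↔ x - y ∈ p ^ v := fun x y => Ideal.Quotient.eq
  have houtinj : Function.Injective out := Function.injective_surjInv _
  let E : R ⧸ p ^ v → ℕ∞ := fun d => ordAt p (out d)
  have hE : ∀ x, x ∉ p ^ v → ordAt p x = E (mk x) := by
    intro x hx
    refine ordAt_congr p ((hmk _ _).1 (hout _).symm) hx
  have hElt : ∀ d, d ≠ 0 → E d < v := by
    intro d hd
    rw [← not_le, le_ordAt]
    intro h
    apply hd
    rw [← hout d]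
    exact Ideal.Quotient.eq_zero_iff_mem.2 h
  let D := B.image mk
  have hDcard : D.card = B.card := by
    apply Finset.card_image_of_injOn
    intro x hx y hy hxy
    by_contra hne
    exact hBp x hx y hy hne (hpv ((hmk _ _).1 hxy))
  have hw : ∑ d ∈ Finset.univ.erase 0, E d ≠ ⊤ := by
    rw [ENat.sum_ne_top]
    intro d hd
    exact ((hElt d (Finset.ne_of_mem_erase hd)).trans_le le_top).ne
  obtain ⟨w, hw⟩ := ENat.ne_top_iff_exists.1 hw
  refine ⟨(Finset.univ \ D).image out, w, ?_, ?_⟩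
  · rw [Finset.card_image_of_injective _ houtinj, Finset.card_sdiff_of_subset (Finset.subset_univ _), hDcard,
      Finset.card_univ, ← Nat.card_eq_fintype_card]
    exact Nat.sub_le_sub_right (card_quot_pow_le p hp v hv) _
  intro g
  have hord : ordAt p (∏ c ∈ (Finset.univ \ D).image out, (g - c)) =
      ∑ d ∈ Finset.univ \ D, ordAt p (g - out d) := by
    rw [Finset.prod_image houtinj.injOn, ordAt_prod p hp]
  have hterm : ∀ d, d ≠ mk g → ordAt p (g - out d) = E (mk g - d) := by
    intro d hd
    rw [hE]
    · rw [map_sub]; congr 2; exact hout d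
    · intro h
      apply hd
      rw [← hout d]
      exact ((hmk _ _).2 h).symm
  have hwg : (w : ℕ∞) = ∑ d ∈ Finset.univ.erase (mk g), E (mk g - d) := by
    rw [hw]
    refine Finset.sum_bij' (fun d _ => mk g - d) (fun d _ => mk g - d) ?_ ?_ ?_ ?_ ?_
    · intro d hd; simpa using hd
    · intro d hd
      simp only [Finset.mem_erase, Finset.mem_univ, and_true] at hd ⊢
      exact fun h => hd (sub_eq_zero.1 h).symm
    · intro d _; simp
    · intro d _; simp
    · intro d _; simp
  have hsplit : (w : ℕ∞) = ∑ d ∈ (Finset.univ \ D).erase (mk g), E (mk g - d) +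
      ∑ d ∈ D.erase (mk g), E (mk g - d) := by
    rw [hwg, ← Finset.sum_union]
    · congr 1
      ext d
      simp only [Finset.mem_erase, Finset.mem_union, Finset.mem_sdiff, Finset.mem_univ, true_and,
        and_true]
      tauto
    · rw [Finset.disjoint_left]
      intro d hd hd'
      simp only [Finset.mem_erase, Finset.mem_sdiff] at hd hd'
      exact hd.2.2 hd'.2
  have hzero : ∀ d ∈ D, d ≠ mk g → (∀ x, mk x = d → g - x ∉ p) → E (mk g - d) = 0 := by
    intro d hd hne h
    rw [← hterm d hne]
    by_contra h0
    have : ((1 : ℕ) : ℕ∞) ≤ ordAt p (g - out d) := by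
      simpa using Order.one_le_iff_ne_zero.2 h0
    rw [le_ordAt, pow_one] at this
    exact h _ (hout d) this
  have hpmk : ∀ x y, mk x = mk y → x - y ∈ p := fun x y h => hpv ((hmk _ _).1 h)
  constructor
  · rintro ⟨b, hb, hgb⟩
    have hmkb : mk g = mk b := (hmk _ _).2 hgb
    have hgD : mk g ∈ D := hmkb ▸ Finset.mem_image_of_mem _ hb
    rw [hord, hsplit]
    have h0 : ∑ d ∈ D.erase (mk g), E (mk g - d) = 0 := by
      refine Finset.sum_eq_zero fun d hd => ?_
      obtain ⟨hne, hdD⟩ := Finset.mem_erase.1 hd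
      refine hzero d hdD hne fun x hx hgx => ?_
      obtain ⟨b', hb', rfl⟩ := Finset.mem_image.1 hdD
      refine hBp b hb b' hb' ?_ ?_
      · rintro rfl; exact hne hmkb.symm
      · have h1 := hpmk _ _ hx
        have h2 := hpmk _ _ hmkb
        have := p.add_mem (p.sub_mem hgx h2) h1
        convert this using 1; ring
    rw [h0, add_zero, Finset.erase_eq_of_notMem (by simp [hgD])]
    refine Finset.sum_congr rfl fun d hd => hterm d ?_
    rintro rfl
    exact (Finset.mem_sdiff.1 hd).2 hgD
  · intro hno
    have hgD : mk g ∉ D := by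
      intro h
      obtain ⟨b, hb, hbg⟩ := Finset.mem_image.1 h
      exact hno ⟨b, hb, (hmk _ _).1 hbg.symm⟩
    rw [hord, ← Finset.add_sum_erase _ _ (a := mk g) (by simp [hgD]), hsplit]
    have hs1 : ∑ d ∈ (Finset.univ \ D).erase (mk g), ordAt p (g - out d) =
        ∑ d ∈ (Finset.univ \ D).erase (mk g), E (mk g - d) :=
      Finset.sum_congr rfl fun d hd => hterm d (Finset.ne_of_mem_erase hd)
    rw [hs1]
    have hv' : (v : ℕ∞) ≤ ordAt p (g - out (mk g)) := by
      rw [le_ordAt, ← hmk, hout]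
    have ht : ∑ d ∈ D.erase (mk g), E (mk g - d) < v := by
      rw [Finset.erase_eq_of_notMem hgD]
      have hneD : ∀ d ∈ D, d ≠ mk g := by rintro d hd rfl; exact hgD hd
      by_cases hex : ∃ b ∈ B, g - b ∈ p
      · obtain ⟨b, hb, hgb⟩ := hex
        have hbD : mk b ∈ D := Finset.mem_image_of_mem _ hb
        rw [Finset.sum_eq_single_of_mem (mk b) hbD]
        · exact hElt _ (sub_ne_zero.2 (hneD _ hbD).symm)
        · intro d hd hdb
          refine hzero d hd (hneD d hd) fun x hx hgx => ?_
          obtain ⟨b', hb', rfl⟩ := Finset.mem_image.1 hd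
          refine hBp b hb b' hb' ?_ ?_
          · rintro rfl; exact hdb rfl
          · have h1 := hpmk _ _ hx
            have := p.add_mem (p.sub_mem hgx hgb) h1
            convert this using 1; ring
      · rw [Finset.sum_eq_zero]
        · exact_mod_cast hv
        · intro d hd
          refine hzero d hd (hneD d hd) fun x hx hgx => ?_
          obtain ⟨b', hb', rfl⟩ := Finset.mem_image.1 hd
          refine hex ⟨b', hb', ?_⟩
          have := p.add_mem hgx (hpmk _ _ hx)
          convert this using 1; ring
    have hfin : ∑ d ∈ (Finset.univ \ D).erase (mk g), E (mk g - d) ≠ ⊤ := by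
      rw [ENat.sum_ne_top]
      intro d hd
      exact ((hElt _ (sub_ne_zero.2 (Finset.ne_of_mem_erase hd).symm)).trans_le le_top).ne
    rw [add_comm]
    exact (ENat.add_lt_add_iff_right hfin).2 (ht.trans_le hv')
end

theorem stmt12 (R : Type*) [CommRing R] [IsDomain R] [IsDedekindDomain R]
    (p : Ideal R) (hp : p.IsMaximal) [Fintype (R ⧸ p)]
    (q : ℕ) (hq : q = Fintype.card (R ⧸ p))
    (n r : ℕ) (hn : 0 < n) (hr : 0 < r)
    (v : Fin r → ℕ) (hv : ∀ j, 1 ≤ v j)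
    (A : Fin n → Finset R) (hA : ∀ i, (A i).Nonempty)
    (B : Fin r → Finset R) (hB : ∀ j, (B j).Nonempty)
    (hAp : ∀ i, ∀ x ∈ A i, ∀ y ∈ A i, x ≠ y → x - y ∉ p)
    (hBp : ∀ j, ∀ x ∈ B j, ∀ y ∈ B j, x ≠ y → x - y ∉ p)
    (f : Fin r → MvPolynomial (Fin n) R)
    (Z : Set (Fin n → R))
    (hZ : Z = {x | (∀ i, x i ∈ A i) ∧
      ∀ j, ∃ b ∈ B j, eval x (f j) - b ∈ p ^ (v j)}) :
    Z.ncard = 0 ∨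
      mBound n (fun i => (A i).card)
        ((∑ i, (A i).card) - ∑ j, (q ^ (v j) - (B j).card) * (f j).totalDegree)
        ≤ Z.ncard := by
  classical
  choose T w hTc hT using fun j => sep_poly p hp (v j) (hv j) (B j) (hBp j)
  let F : MvPolynomial (Fin n) R := ∏ j, ∏ c ∈ T j, (f j - C c)
  let W : ℕ := ∑ j, w j
  have hdeg : F.totalDegree ≤ ∑ j, (q ^ (v j) - (B j).card) * (f j).totalDegree := by
    refine (totalDegree_finsetProd _ _).trans (Finset.sum_le_sum fun j _ => ?_)
    refine (totalDegree_finsetProd _ _).trans ?_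
    calc ∑ c ∈ T j, (f j - C c).totalDegree ≤ ∑ _c ∈ T j, (f j).totalDegree :=
          Finset.sum_le_sum (f := fun c => (f j - C c).totalDegree)
            fun c _ => totalDegree_sub_C_le _ _
      _ = (T j).card * (f j).totalDegree := by simp
      _ ≤ _ := by
        rw [hq]
        exact Nat.mul_le_mul_right _ (hTc j)
  have hord : ∀ x, ordAt p (eval x F) = ∑ j, ordAt p (∏ c ∈ T j, (eval x (f j) - c)) := by
    intro x
    simp only [F, map_prod, map_sub, eval_C]
    rw [ordAt_prod p hp]
  have hmem : ∀ x, eval x F ∉ p ^ (W + 1) ↔ ∀ j, ∃ b ∈ B j, eval x (f j) - b ∈ p ^ (v j) := by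
    intro x
    have hle : ∀ j, (w j : ℕ∞) ≤ ordAt p (∏ c ∈ T j, (eval x (f j) - c)) := by
      intro j
      by_cases h : ∃ b ∈ B j, eval x (f j) - b ∈ p ^ (v j)
      · exact ((hT j _).1 h).ge
      · exact ((hT j _).2 h).le
    rw [← le_ordAt, hord]
    constructor
    · intro h j
      by_contra hj
      apply h
      have h1 : ((w j + 1 : ℕ) : ℕ∞) ≤ ordAt p (∏ c ∈ T j, (eval x (f j) - c)) := by
        have := (hT j _).2 hj
        push_cast
        exact Order.add_one_le_of_lt this
      have h2 : W + 1 = (w j + 1) + ∑ k ∈ Finset.univ.erase j, w k := by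
        simp only [W]
        rw [← Finset.add_sum_erase _ _ (Finset.mem_univ j)]
        ring
      rw [h2, ← Finset.add_sum_erase _ _ (Finset.mem_univ j), Nat.cast_add, Nat.cast_sum]
      exact add_le_add h1 (Finset.sum_le_sum fun k _ => hle k)
    · intro h
      rw [Finset.sum_congr rfl fun j _ => (hT j _).1 (h j), ← Nat.cast_sum]
      simp only [Nat.cast_le, not_le, W]
      omega
  have hZ' : Z = ↑((Fintype.piFinset A).filter (fun x => eval x F ∉ p ^ (W + 1))) := by
    ext x
    rw [hZ, Finset.mem_coe, Finset.mem_filter, hmem, Fintype.mem_piFinset, Set.mem_ofPred_eq]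
  rw [hZ', Set.ncard_coe_finset]
  by_cases h0 : ((Fintype.piFinset A).filter (fun x => eval x F ∉ p ^ (W + 1))).card = 0
  · left; exact h0
  right
  have hex : ∃ x ∈ Fintype.piFinset A, eval x F ∉ p ^ (W + 1) := by
    obtain ⟨x, hx⟩ := Finset.card_pos.1 (Nat.pos_of_ne_zero h0)
    exact ⟨x, (Finset.mem_filter.1 hx).1, (Finset.mem_filter.1 hx).2⟩
  obtain ⟨y, hy1, hy2, hy3⟩ := af_main (p ^ (W + 1)) _ A hA rfl (by
    intro i x hx y hy hxy z hz
    exact (Ideal.IsMaximal.mul_mem_pow p hz).resolve_left (hAp i x hx y hy hxy)) F hex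
  unfold mBound
  split_ifs with hN
  · omega
  · push Not at hN
    obtain ⟨z, hz, hzs⟩ := exists_lower _ hN (∑ i, y i - (∑ i, (A i).card -
      ∑ j, (q ^ (v j) - (B j).card) * (f j).totalDegree)) y (fun i => (hy1 i).1) (by omega)
    refine le_trans (Nat.sInf_le (m := ∏ i, z i)
      (Set.mem_image_of_mem _ ⟨fun i => ⟨(hz i).1, (hz i).2.trans (hy1 i).2⟩, hzs⟩)) ?_
    refine le_trans (Finset.prod_le_prod' fun i _ => (hz i).2) ?_
    convert hy3
end

section
/- (Main Theorem mod p^v) Let p be a prime, n, r, v positive integers, and 1 ≤ v_j ≤ v for 1 ≤ j ≤ r. Let A_1,...,A_n, B_1,...,B_r ⊂ Z/p^v Z be nonempty sets with no two distinct elements congruent modulo p. Let f_1,...,f_r ∈ (Z/p^v Z)[t_1,...,t_n]. Let Z = {x ∈ ΠA_i : for each j, f_j(x) ∈ B_j (mod p^{v_j})}. Then Z = ∅ or #Z ≥ m(#A_1,...,#A_n; Σ_i #A_i - Σ_j (p^{v_j} - #B_j)·deg f_j). -/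
open MvPolynomial

/-- splitting off a root in the zeroth variable, with degree control -/
def SplitProp {K : Type*} [Field K] {n : ℕ} (x : K) (D : ℕ)
    (G : MvPolynomial (Fin (n + 1)) K) : Prop :=
  ∃ (H : MvPolynomial (Fin (n + 1)) K) (R : MvPolynomial (Fin n) K),
    G = (X 0 - C x) * H + rename Fin.succ R ∧ (H = 0 ∨ H.totalDegree < D) ∧ R.totalDegree ≤ D

theorem splitProp_add {K : Type*} [Field K] {n : ℕ} (x : K) (D : ℕ)
    (G G' : MvPolynomial (Fin (n + 1)) K) (h : SplitProp x D G) (h' : SplitProp x D G') :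
    SplitProp x D (G + G') := by
  obtain ⟨H, R, rfl, hH, hR⟩ := h
  obtain ⟨H', R', rfl, hH', hR'⟩ := h'
  refine ⟨H + H', R + R', by simp only [map_add]; ring, ?_,
    (totalDegree_add _ _).trans (max_le hR hR')⟩
  rcases hH with rfl | hH
  · simpa using hH'
  · rcases hH' with rfl | hH'
    · simpa using Or.inr hH
    · exact Or.inr (lt_of_le_of_lt (totalDegree_add _ _) (max_lt hH hH'))

theorem splitProp_mul_X {K : Type*} [Field K] {n : ℕ} (x : K) (D : ℕ)
    (G : MvPolynomial (Fin (n + 1)) K) (i : Fin (n + 1)) (h : SplitProp x D G) :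
    SplitProp x (D + 1) (G * X i) := by
  obtain ⟨H, R, rfl, hH, hR⟩ := h
  have hHX : ∀ i : Fin (n + 1), (H * X i).totalDegree ≤ D := by
    intro i
    rcases hH with rfl | hH
    · simp
    · refine (totalDegree_mul _ _).trans ?_
      rw [totalDegree_X]; omega
  refine Fin.cases ?_ (fun i => ?_) i
  · refine ⟨H * X 0 + rename Fin.succ R, R * C x, ?_, Or.inr ?_, ?_⟩
    · simp only [map_mul, rename_C]; ring
    · have h1 := totalDegree_add (H * X 0) (rename Fin.succ R)
      have h2 := totalDegree_rename_le Fin.succ R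
      have h3 := hHX 0
      omega
    · have := totalDegree_mul R (C x)
      rw [totalDegree_C] at this; omega
  · refine ⟨H * X i.succ, R * X i, ?_, Or.inr ?_, ?_⟩
    · simp only [map_mul, rename_X]; ring
    · have := hHX i.succ; omega
    · have := totalDegree_mul R (X i)
      rw [totalDegree_X] at this; omega

theorem splitProp_mono {K : Type*} [Field K] {n : ℕ} (x : K) {D D' : ℕ} (hD : D ≤ D')
    (G : MvPolynomial (Fin (n + 1)) K) (h : SplitProp x D G) : SplitProp x D' G := by
  obtain ⟨H, R, hG, hH, hR⟩ := h
  exact ⟨H, R, hG, hH.imp id (fun h => h.trans_le hD), hR.trans hD⟩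

theorem splitProp_monomial {K : Type*} [Field K] {n : ℕ} (x : K) (c : K) (d : ℕ) :
    ∀ m : Fin (n + 1) →₀ ℕ, m.degree = d → SplitProp x d (monomial m c) := by
  induction d with
  | zero =>
    intro m hm
    have : m = 0 := (Finsupp.degree_eq_zero_iff m).1 hm
    subst this
    exact ⟨0, C c, by simp, Or.inl rfl, by simp⟩
  | succ d ih =>
    intro m hm
    have hne : m ≠ 0 := by rintro rfl; simp at hm
    obtain ⟨i, hi⟩ := Finsupp.ne_iff.1 hne
    have hle : Finsupp.single i 1 ≤ m := by
      rw [Finsupp.single_le_iff]; exact Nat.one_le_iff_ne_zero.2 hi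
    obtain ⟨m', rfl⟩ := le_iff_exists_add'.1 hle
    have h1 : m'.degree = d := by simpa using hm
    have := splitProp_mul_X x d _ i (ih m' h1)
    rwa [X, monomial_mul, mul_one] at this

theorem splitProp_of_totalDegree {K : Type*} [Field K] {n : ℕ} (x : K) (D : ℕ)
    (G : MvPolynomial (Fin (n + 1)) K) (hG : G.totalDegree ≤ D) : SplitProp x D G := by
  rw [G.as_sum]
  have : ∀ s ⊆ G.support, SplitProp x D (∑ m ∈ s, monomial m (coeff m G)) := by
    intro s
    induction s using Finset.induction_on with
    | empty => intro _; exact ⟨0, 0, by simp, Or.inl rfl, by simp⟩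
    | insert m s hm ih =>
      intro hs
      rw [Finset.sum_insert hm]
      refine splitProp_add _ _ _ _ (splitProp_mono x ?_ _ (splitProp_monomial x _ _ m rfl))
        (ih fun a ha => hs (Finset.mem_insert_of_mem ha))
      exact (le_totalDegree (hs (Finset.mem_insert_self _ _))).trans hG
  exact this _ subset_rfl

theorem eval_cons_rename {K : Type*} [Field K] {n : ℕ} (R : MvPolynomial (Fin n) K)
    (z : Fin (n + 1) → K) : eval z (rename Fin.succ R) = eval (Fin.tail z) R := by
  rw [eval_rename]; rfl

theorem af_divide {K : Type*} [Field K] {n : ℕ} (D : ℕ) (A : Fin (n + 1) → Finset K)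
    (G : MvPolynomial (Fin (n + 1)) K) (hG : G.totalDegree ≤ D)
    (hne : ∃ z, (∀ i, z i ∈ A i) ∧ eval z G ≠ 0) (T : Finset K) (hTA : T ⊆ A 0)
    (hT : ∀ z, (∀ i, z i ∈ A i) → z 0 ∈ T → eval z G = 0) :
    ∃ H : MvPolynomial (Fin (n + 1)) K, H.totalDegree + T.card ≤ D ∧
      ∀ z, (∀ i, z i ∈ A i) → eval z G = (∏ t ∈ T, (z 0 - t)) * eval z H := by
  classical
  induction T using Finset.induction_on with
  | empty => exact ⟨G, by simpa using hG, by simp⟩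
  | insert t T ht ih =>
    obtain ⟨H, hH, hGH⟩ := ih (fun a ha => hTA (Finset.mem_insert_of_mem ha))
      (fun z hz hz0 => hT z hz (Finset.mem_insert_of_mem hz0))
    obtain ⟨H', R, hHR, hH', hR⟩ := splitProp_of_totalDegree t _ H le_rfl
    have hR0 : ∀ z, (∀ i, z i ∈ A i) → eval (Fin.tail z) R = 0 := by
      intro z hz
      have hz' : ∀ i, (Fin.cons t (Fin.tail z) : Fin (n + 1) → K) i ∈ A i := by
        intro i
        refine Fin.cases ?_ (fun i => ?_) i
        · simpa using hTA (Finset.mem_insert_self _ _)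
        · simpa [Fin.tail] using hz i.succ
      have h1 := hT _ hz' (by simp)
      rw [hGH _ hz', mul_eq_zero] at h1
      rcases h1 with h1 | h1
      · obtain ⟨a, ha, ha'⟩ := Finset.prod_eq_zero_iff.1 h1
        simp only [Fin.cons_zero, sub_eq_zero] at ha'
        exact absurd (ha' ▸ ha) ht
      · rw [hHR] at h1
        simpa [eval_cons_rename] using h1
    have hfin : ∀ z, (∀ i, z i ∈ A i) →
        eval z G = (∏ s ∈ insert t T, (z 0 - s)) * eval z H' := by
      intro z hz
      rw [hGH z hz, Finset.prod_insert ht, hHR]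
      simp only [map_add, map_mul, map_sub, eval_X, eval_C, eval_cons_rename, hR0 z hz]
      ring
    refine ⟨H', ?_, hfin⟩
    rcases hH' with rfl | hH'
    · obtain ⟨z, hz, hz'⟩ := hne
      exact absurd (by simpa using hfin z hz) hz'
    · rw [Finset.card_insert_of_notMem ht]; omega

/-- Alon-Füredi -/
theorem alon_furedi {K : Type*} [Field K] [DecidableEq K] (n : ℕ) : ∀ (D : ℕ) (A : Fin n → Finset K)
    (G : MvPolynomial (Fin n) K) (_ : G.totalDegree ≤ D)
    (_ : ∃ z, (∀ i, z i ∈ A i) ∧ eval z G ≠ 0),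
    ∃ y : Fin n → ℕ, (∀ i, 1 ≤ y i ∧ y i ≤ (A i).card) ∧ ∑ i, (A i).card ≤ ∑ i, y i + D ∧
      ∏ i, y i ≤ ((Fintype.piFinset A).filter (fun z => eval z G ≠ 0)).card := by
  induction n with
  | zero =>
    intro D A G hG ⟨z, hz, hz'⟩
    refine ⟨fun _ => 1, by simp, by simp, ?_⟩
    simp only [Finset.univ_eq_empty, Finset.prod_empty]
    exact Finset.card_pos.2 ⟨z, by simp only [Finset.mem_filter, Fintype.mem_piFinset]; exact ⟨hz, hz'⟩⟩
  | succ n ih =>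
    intro D A G hG hne
    classical
    set T := (A 0).filter (fun t => ∀ z, (∀ i, z i ∈ A i) → z 0 = t → eval z G = 0) with hTdef
    set U := A 0 \ T with hU
    have hTA : T ⊆ A 0 := Finset.filter_subset _ _
    obtain ⟨H, hH, hGH⟩ := af_divide D A G hG hne T hTA (fun z hz hz0 =>
      (Finset.mem_filter.1 hz0).2 z hz rfl)
    have hcardU : U.card + T.card = (A 0).card := Finset.card_sdiff_add_card_eq_card hTA
    have key : ∀ u ∈ U, ∃ y : Fin n → ℕ, (∀ i, 1 ≤ y i ∧ y i ≤ (A i.succ).card) ∧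
        ∑ i : Fin n, (A i.succ).card + T.card ≤ ∑ i, y i + D ∧
        ∏ i, y i ≤ ((Fintype.piFinset A).filter
          (fun z => z 0 = u ∧ eval z G ≠ 0)).card := by
      intro u hu
      have huA : u ∈ A 0 := (Finset.mem_sdiff.1 hu).1
      have huT : u ∉ T := (Finset.mem_sdiff.1 hu).2
      obtain ⟨H', R, hHR, hH', hR⟩ := splitProp_of_totalDegree u _ H le_rfl
      have hRev : ∀ x, eval (Fin.cons u x : Fin (n + 1) → K) H = eval x R := by
        intro x; rw [hHR]; simp [eval_cons_rename]
      obtain ⟨y, hy1, hy2, hy3⟩ := ih R.totalDegree (fun i => A i.succ) R le_rfl (by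
        by_contra! hcon
        refine huT (Finset.mem_filter.2 ⟨huA, fun z hz hz0 => ?_⟩)
        rw [hGH z hz]
        have : z = Fin.cons u (Fin.tail z) := by rw [← hz0, Fin.cons_self_tail]
        rw [this, hRev, hcon (Fin.tail z) (fun i => hz i.succ), mul_zero])
      refine ⟨y, hy1, by omega, hy3.trans ?_⟩
      refine Finset.card_le_card_of_injOn (fun x => (Fin.cons u x : Fin (n + 1) → K)) ?_ ?_
      · intro x hx
        simp only [Finset.coe_filter, Fintype.mem_piFinset, Set.mem_ofPred_eq] at hx ⊢
        have hc : ∀ i, (Fin.cons u x : Fin (n + 1) → K) i ∈ A i := by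
          intro i
          refine Fin.cases ?_ (fun i => ?_) i
          · simpa using huA
          · simpa using hx.1 i
        refine ⟨hc, by simp, ?_⟩
        rw [hGH _ hc, hRev]
        refine mul_ne_zero (Finset.prod_ne_zero_iff.2 fun t ht => ?_) hx.2
        simp only [Fin.cons_zero, ne_eq, sub_eq_zero]
        rintro rfl; exact huT ht
      · intro a _ b _ hab
        exact (Fin.cons_injective2 hab).2
    have hUne : U.Nonempty := by
      obtain ⟨z, hz, hz'⟩ := hne
      exact ⟨z 0, Finset.mem_sdiff.2 ⟨hz 0, fun h => hz' ((Finset.mem_filter.1 h).2 z hz rfl)⟩⟩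
    obtain ⟨u, hu, humin⟩ := Finset.exists_min_image U (fun u => ((Fintype.piFinset A).filter
          (fun z => z 0 = u ∧ eval z G ≠ 0)).card) hUne
    obtain ⟨y, hy1, hy2, hy3⟩ := key u hu
    refine ⟨Fin.cons U.card y, ?_, ?_, ?_⟩
    · intro i
      refine Fin.cases ?_ (fun i => ?_) i
      · simp only [Fin.cons_zero]
        exact ⟨Finset.card_pos.2 hUne, by omega⟩
      · simpa using hy1 i
    · rw [Fin.sum_univ_succ, Fin.sum_cons]; omega
    · rw [Fin.prod_cons]
      have hfib := Finset.card_eq_sum_card_fiberwise (f := fun z : Fin (n + 1) → K => z 0)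
        (s := (Fintype.piFinset A).filter (fun z => z 0 ∈ U ∧ eval z G ≠ 0)) (t := U)
        (by intro z hz; simp at hz ⊢; exact hz.2.1)
      have hle : U.card * ∏ i, y i ≤
          ((Fintype.piFinset A).filter (fun z => z 0 ∈ U ∧ eval z G ≠ 0)).card := by
        rw [hfib, ← smul_eq_mul]
        refine Finset.card_nsmul_le_sum _ _ _ fun u' hu' => (hy3.trans (humin u' hu')).trans ?_
        refine Finset.card_le_card fun z hz => ?_
        simp only [Finset.mem_filter] at hz ⊢
        exact ⟨⟨hz.1, hz.2.1 ▸ hu', hz.2.2⟩, hz.2.1⟩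
      refine hle.trans (Finset.card_le_card fun z hz => ?_)
      simp only [Finset.mem_filter] at hz ⊢
      exact ⟨hz.1, hz.2.2⟩

theorem exists_lift {σ R S : Type*} [CommRing R] [CommRing S] (φ : R →+* S)
    (hφ : Function.Surjective φ) (f : MvPolynomial σ S) :
    ∃ F : MvPolynomial σ R, map φ F = f ∧ F.totalDegree ≤ f.totalDegree ∧ (f = 0 → F = 0) := by
  choose s hs using hφ
  refine ⟨∑ m ∈ f.support, monomial m (s (coeff m f)), ?_, ?_, ?_⟩
  · rw [map_sum]
    conv_rhs => rw [f.as_sum]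
    exact Finset.sum_congr rfl fun m _ => by rw [map_monomial, hs]
  · refine totalDegree_finsetSum_le fun m hm => ?_
    exact (totalDegree_monomial_le _ _).trans (le_totalDegree hm)
  · rintro rfl; simp

theorem eval_map_int {n q : ℕ} (F : MvPolynomial (Fin n) ℤ) (x : Fin n → ℤ) :
    eval (fun i => (x i : ZMod q)) (map (Int.castRingHom (ZMod q)) F) = ((eval x F : ℤ) : ZMod q) := by
  exact map_eval (Int.castRingHom (ZMod q)) x F |>.symm

theorem totalDegree_prod_mul {σ K : Type*} [Field K] (i : σ) (S : Finset K)
    (h : MvPolynomial σ K) (hh : h ≠ 0) :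
    (∏ s ∈ S, (X i - C s)) * h ≠ 0 ∧
    ((∏ s ∈ S, (X i - C s)) * h).totalDegree = S.card + h.totalDegree := by
  classical
  have h1 : ∀ s : K, (X i - C s : MvPolynomial σ K).totalDegree = 1 := by
    intro s
    rw [sub_eq_add_neg, ← C_neg, totalDegree_add_eq_left_of_totalDegree_lt (by simp), totalDegree_X]
  have h2 : ∀ s : K, (X i - C s : MvPolynomial σ K) ≠ 0 := by
    intro s hs; have := h1 s; rw [hs] at this; simp at this
  induction S using Finset.induction_on with
  | empty => simpa using hh
  | insert t T ht ih =>
    rw [Finset.prod_insert ht, mul_assoc, Finset.card_insert_of_notMem ht]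
    refine ⟨mul_ne_zero (h2 t) ih.1, ?_⟩
    rw [totalDegree_mul_of_isDomain (h2 t) ih.1, h1, ih.2]; ring

/-- Nullstellensatz over a field, lifted to the integers. -/
theorem grid_lift {K : Type*} [Field K] (φ : ℤ →+* K) (hφs : Function.Surjective φ)
    {n : ℕ} (A : Fin n → Finset ℤ) (hA : ∀ i, (A i).Nonempty)
    (hinj : ∀ i, Set.InjOn φ (A i)) (F : MvPolynomial (Fin n) ℤ)
    (hF : ∀ x, (∀ i, x i ∈ A i) → φ (eval x F) = 0) :
    ∃ F' : MvPolynomial (Fin n) ℤ, map φ F' = 0 ∧ F'.totalDegree ≤ F.totalDegree ∧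
      ∀ x, (∀ i, x i ∈ A i) → eval x F = eval x F' := by
  classical
  have hdeg : (map φ F).totalDegree ≤ F.totalDegree :=
    Finset.sup_mono (support_map_subset _ _)
  obtain ⟨h, hh, hF2⟩ := combinatorial_nullstellensatz_exists_linearCombination
    (fun i => (A i).image φ) (fun i => (hA i).image _)
    (map φ F) (by
      intro x hx
      have : ∀ i, ∃ a ∈ A i, φ a = x i := fun i => by simpa using hx i
      choose a ha hax using this
      have h1 := map_eval φ a F
      rw [show φ ∘ a = x from funext hax, hF a ha] at h1
      exact h1.symm)
  have hlift := fun i => exists_lift φ hφs (h i)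
  choose H hH1 hH2 hH3 using hlift
  have hF3 : map φ F = ∑ i, (h i) * ∏ r ∈ A i, (X i - C (φ r)) := by
    rw [hF2, Finsupp.linearCombination_apply, Finsupp.sum_fintype _ _ (by simp)]
    refine Finset.sum_congr rfl fun i _ => ?_
    rw [Finset.prod_image (hinj i), smul_eq_mul]
  refine ⟨F - ∑ i, H i * ∏ r ∈ A i, (X i - C r), ?_, ?_, ?_⟩
  · rw [map_sub, hF3, map_sum, sub_eq_zero]
    refine Finset.sum_congr rfl fun i _ => ?_
    rw [map_mul, map_prod, hH1]
    congr 1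
    refine Finset.prod_congr rfl fun r _ => ?_
    rw [map_sub, map_X, map_C]
  · refine (totalDegree_sub _ _).trans (max_le le_rfl (totalDegree_finsetSum_le fun i _ => ?_))
    by_cases hi : h i = 0
    · simp [hH3 i hi]
    · have h1 := hh i
      rw [(totalDegree_prod_mul i _ (h i) hi).2, Finset.card_image_of_injOn (hinj i)] at h1
      have h2 := totalDegree_mul (H i) (∏ r ∈ A i, (X i - C r))
      have h3 := totalDegree_finsetProd (A i) (fun r => (X i - C r : MvPolynomial (Fin n) ℤ))
      have h4 : ∑ r ∈ A i, (X i - C r : MvPolynomial (Fin n) ℤ).totalDegree ≤ ∑ r ∈ A i, 1 :=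
        Finset.sum_le_sum fun r _ => (totalDegree_sub_C_le _ _).trans (totalDegree_X _).le
      rw [Finset.sum_const, smul_eq_mul, mul_one] at h4
      have h5 := hH2 i
      omega
  · intro x hx
    rw [map_sub, map_sum, Finset.sum_eq_zero, sub_zero]
    intro i _
    rw [map_mul, map_prod, Finset.prod_eq_zero (hx i), mul_zero]
    simp

/-- if all values on the grid are divisible by `p`, divide by `p`. -/
theorem grid_divide_one (p : ℕ) [Fact p.Prime] {n : ℕ} (A : Fin n → Finset ℤ)
    (hA : ∀ i, (A i).Nonempty)
    (hinj : ∀ i, Set.InjOn (fun a : ℤ => (a : ZMod p)) (A i)) (F : MvPolynomial (Fin n) ℤ)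
    (hF : ∀ x, (∀ i, x i ∈ A i) → (p : ℤ) ∣ eval x F) :
    ∃ G : MvPolynomial (Fin n) ℤ, G.totalDegree ≤ F.totalDegree ∧
      ∀ x, (∀ i, x i ∈ A i) → eval x F = p * eval x G := by
  have hp0 : (p : ℤ) ≠ 0 := by exact_mod_cast (Fact.out : p.Prime).ne_zero
  obtain ⟨F', hmap, hdF', hev⟩ := grid_lift (Int.castRingHom (ZMod p)) ZMod.intCast_surjective
    A hA hinj F (fun x hx => (ZMod.intCast_zmod_eq_zero_iff_dvd _ _).2 (hF x hx))
  have hdvd : C (p : ℤ) ∣ F' := by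
    rw [C_dvd_iff_dvd_coeff]
    intro m
    have := congrArg (coeff m) hmap
    rw [coeff_map, coeff_zero] at this
    exact (ZMod.intCast_zmod_eq_zero_iff_dvd _ _).1 this
  obtain ⟨G, hG⟩ := hdvd
  refine ⟨G, le_trans (totalDegree_le_of_support_subset ?_) hdF', ?_⟩
  · intro m hm
    rw [mem_support_iff] at hm ⊢
    rw [hG, coeff_C_mul]
    exact mul_ne_zero hp0 hm
  · intro x hx
    rw [hev x hx, hG, map_mul, eval_C]

theorem grid_divide (p : ℕ) [Fact p.Prime] {n : ℕ} (A : Fin n → Finset ℤ)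
    (hA : ∀ i, (A i).Nonempty)
    (hinj : ∀ i, Set.InjOn (fun a : ℤ => (a : ZMod p)) (A i)) (E : ℕ) :
    ∀ (F : MvPolynomial (Fin n) ℤ)
    (_ : ∀ x, (∀ i, x i ∈ A i) → (p : ℤ) ^ E ∣ eval x F),
    ∃ G : MvPolynomial (Fin n) ℤ, G.totalDegree ≤ F.totalDegree ∧
      ∀ x, (∀ i, x i ∈ A i) → eval x F = p ^ E * eval x G := by
  have hp0 : (p : ℤ) ≠ 0 := by exact_mod_cast (Fact.out : p.Prime).ne_zero
  induction E with
  | zero => exact fun F _ => ⟨F, le_rfl, by simp⟩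
  | succ E ih =>
    intro F hF
    obtain ⟨G, hG1, hG2⟩ := grid_divide_one p A hA hinj F
      (fun x hx => (dvd_pow_self _ (Nat.succ_ne_zero E)).trans (hF x hx))
    obtain ⟨G', hG1', hG2'⟩ := ih G (fun x hx => by
      have := hF x hx
      rw [hG2 x hx, pow_succ'] at this
      exact (mul_dvd_mul_iff_left hp0).1 this)
    refine ⟨G', hG1'.trans hG1, fun x hx => ?_⟩
    rw [hG2 x hx, hG2' x hx]; ring

theorem nu_spec (p w : ℕ) [Fact p.Prime] [NeZero (p ^ w)] (a : ℤ)
    (ha : (a : ZMod (p ^ w)) ≠ 0) :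
    padicValNat p (a : ZMod (p ^ w)).val < w ∧
    ∃ u : ℤ, a = (p : ℤ) ^ padicValNat p (a : ZMod (p ^ w)).val * u ∧ ¬ (p : ℤ) ∣ u := by
  set z := (a : ZMod (p ^ w)).val with hz
  set k := padicValNat p z with hk
  have hp : p.Prime := Fact.out
  have hp0 : (p : ℤ) ≠ 0 := by exact_mod_cast hp.ne_zero
  have hz0 : z ≠ 0 := by rw [hz, Ne, ZMod.val_eq_zero]; exact ha
  have hzlt : z < p ^ w := ZMod.val_lt _
  have hdvd : p ^ k ∣ z := pow_padicValNat_dvd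
  have hkw : k < w := by
    have := (Nat.le_of_dvd (Nat.pos_of_ne_zero hz0) hdvd).trans_lt hzlt
    exact (Nat.pow_lt_pow_iff_right hp.one_lt).1 this
  have haz : ((p : ℤ) ^ w) ∣ a - z := by
    have : ((a - z : ℤ) : ZMod (p ^ w)) = 0 := by
      rw [hz]; simp
    have := (ZMod.intCast_zmod_eq_zero_iff_dvd _ _).1 this
    exact_mod_cast this
  refine ⟨hkw, ?_⟩
  have h1 : (p : ℤ) ^ k ∣ a := by
    have h2 : (p : ℤ) ^ k ∣ z := by exact_mod_cast hdvd
    have := dvd_add ((pow_dvd_pow (p : ℤ) hkw.le).trans haz) h2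
    simpa using this
  obtain ⟨u, hu⟩ := h1
  refine ⟨u, hu, fun hpu => ?_⟩
  have h3 : (p : ℤ) ^ (k + 1) ∣ a := by
    rw [hu, pow_succ]; exact mul_dvd_mul_left _ hpu
  have h4 : (p : ℤ) ^ (k + 1) ∣ (z : ℤ) := by
    have := dvd_sub h3 ((pow_dvd_pow (p : ℤ) hkw).trans haz)
    simpa using this
  exact pow_succ_padicValNat_not_dvd hz0 (by exact_mod_cast h4)

theorem nu_dvd (p w : ℕ) [Fact p.Prime] [NeZero (p ^ w)] (a : ℤ) :
    (p : ℤ) ^ padicValNat p (a : ZMod (p ^ w)).val ∣ a := by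
  by_cases ha : (a : ZMod (p ^ w)) = 0
  · simp [ha]
  · obtain ⟨_, u, hu, _⟩ := nu_spec p w a ha
    exact ⟨u, hu⟩

/-- The univariate integer polynomial detecting `B` modulo `p ^ w`, given by its set of roots. -/
theorem detect (p w : ℕ) [Fact p.Prime] (hw : 1 ≤ w) (B : Finset ℤ)
    (hB : ∀ x ∈ B, ∀ y ∈ B, x ≠ y → ¬ (p : ℤ) ∣ x - y) :
    ∃ (S : Finset ℤ) (e : ℕ), S.card = p ^ w - B.card ∧
      ∀ h : ℤ, ∃ q : ℤ, ∏ s ∈ S, (h - s) = p ^ e * q ∧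
        (¬ (p : ℤ) ∣ q ↔ ∃ b ∈ B, (p : ℤ) ^ w ∣ h - b) := by
  classical
  have hp : p.Prime := Fact.out
  have hpZ : Prime (p : ℤ) := Nat.prime_iff_prime_int.1 hp
  have : NeZero (p ^ w) := ⟨pow_ne_zero _ hp.ne_zero⟩
  have hpw : (p : ℤ) ∣ (p : ℤ) ^ w := dvd_pow_self _ (by omega)
  let ν : ZMod (p ^ w) → ℕ := fun z => padicValNat p z.val
  let Bz : Finset (ZMod (p ^ w)) := B.image (fun b : ℤ => (b : ZMod (p ^ w)))
  have hcast : ∀ a : ℤ, (a : ZMod (p ^ w)) = 0 ↔ (p : ℤ) ^ w ∣ a := fun a => by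
    rw [ZMod.intCast_zmod_eq_zero_iff_dvd]; push_cast; rfl
  have hBinj : Set.InjOn (fun b : ℤ => (b : ZMod (p ^ w))) B := by
    intro x hx y hy hxy
    by_contra hne
    refine hB x hx y hy hne (hpw.trans ((hcast _).1 ?_))
    push_cast
    exact sub_eq_zero.2 hxy
  have hBcard : Bz.card = B.card := Finset.card_image_of_injOn hBinj
  have hvalinj : Function.Injective (fun z : ZMod (p ^ w) => (z.val : ℤ)) := by
    intro a b hab
    have hab' : (a.val : ℤ) = (b.val : ℤ) := hab
    exact ZMod.val_injective _ (by exact_mod_cast hab')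
  have hsum : ∀ z0 : ZMod (p ^ w), ∑ z ∈ Bzᶜ, ν (z0 - z) + ∑ z ∈ Bz, ν (z0 - z) = ∑ z, ν z := by
    intro z0
    rw [add_comm, Finset.sum_add_sum_compl]
    exact (Equiv.subLeft z0).sum_comp ν
  have hν0 : ν 0 = 0 := by simp [ν]
  -- two elements of B are not both close
  have hνpos : ∀ h : ℤ, ∀ b : ℤ, ν ((h : ZMod (p ^ w)) - b) ≠ 0 → (p : ℤ) ∣ h - b := by
    intro h b hne
    have := nu_dvd p w (h - b)
    push_cast at this
    exact (dvd_pow_self _ hne).trans this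
  refine ⟨Bzᶜ.image (fun z => (z.val : ℤ)), ∑ z, ν z, ?_, ?_⟩
  · rw [Finset.card_image_of_injective _ hvalinj, Finset.card_compl, ZMod.card, hBcard]
  intro h
  rw [Finset.prod_image (fun a _ b _ hab => hvalinj hab)]
  have hcz : ∀ z : ZMod (p ^ w), ((h - (z.val : ℤ) : ℤ) : ZMod (p ^ w)) = (h : ZMod (p ^ w)) - z := by
    intro z; simp
  by_cases hmem : (h : ZMod (p ^ w)) ∈ Bz
  · obtain ⟨b, hb, hbh⟩ := Finset.mem_image.1 hmem
    have hhb : (p : ℤ) ^ w ∣ h - b := (hcast _).1 (by push_cast; rw [hbh]; simp)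
    have hex : ∀ z : ZMod (p ^ w), ∃ u : ℤ, z ∈ Bzᶜ →
        (h - (z.val : ℤ)) = (p : ℤ) ^ ν (h - z) * u ∧ ¬ (p : ℤ) ∣ u := by
      intro z
      by_cases hz : z ∈ Bzᶜ
      · have hne : ((h - (z.val : ℤ) : ℤ) : ZMod (p ^ w)) ≠ 0 := by
          rw [hcz, Ne, sub_eq_zero]
          rintro rfl
          exact (Finset.mem_compl.1 hz) hmem
        obtain ⟨_, u, hu, hu'⟩ := nu_spec p w _ hne
        rw [hcz] at hu
        exact ⟨u, fun _ => ⟨hu, hu'⟩⟩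
      · exact ⟨0, fun h => absurd h hz⟩
    choose u hu using hex
    have h0 : ∑ z ∈ Bz, ν (h - z) = 0 := by
      refine Finset.sum_eq_zero fun z hz => ?_
      obtain ⟨b', hb', rfl⟩ := Finset.mem_image.1 hz
      by_cases hbb : b' = b
      · subst hbb; rw [hbh, sub_self, hν0]
      · by_contra hne
        have h1 := hνpos h b' hne
        have h2 := dvd_sub (hpw.trans hhb) h1
        exact hB b' hb' b hb hbb (by simpa using h2)
    refine ⟨∏ z ∈ Bzᶜ, u z, ?_, ?_⟩
    · rw [Finset.prod_congr rfl (fun z hz => (hu z hz).1), Finset.prod_mul_distrib,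
        Finset.prod_pow_eq_pow_sum, ← hsum h, h0, add_zero]
    · refine iff_of_true ?_ ⟨b, hb, hhb⟩
      rw [hpZ.dvd_finsetProd_iff]
      rintro ⟨z, hz, hz'⟩
      exact (hu z hz).2 hz'
  · have hle : ∑ z ∈ Bz, ν (h - z) < w := by
      by_cases hall : ∀ z ∈ Bz, ν (h - z) = 0
      · rw [Finset.sum_eq_zero hall]; omega
      · push Not at hall
        obtain ⟨z1, hz1, hne1⟩ := hall
        rw [Finset.sum_eq_single_of_mem z1 hz1]
        · have hne : ((h - (z1.val : ℤ) : ℤ) : ZMod (p ^ w)) ≠ 0 := by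
            rw [hcz, Ne, sub_eq_zero]
            rintro rfl
            exact hmem hz1
          have := (nu_spec p w _ hne).1
          rwa [hcz] at this
        · intro z hz hzz
          by_contra hne
          obtain ⟨b, hb, rfl⟩ := Finset.mem_image.1 hz
          obtain ⟨b1, hb1, rfl⟩ := Finset.mem_image.1 hz1
          have h2 := dvd_sub (hνpos h b1 hne1) (hνpos h b hne)
          exact hB b hb b1 hb1 (fun hbb => hzz (by rw [hbb])) (by simpa using h2)
    have hin : (h : ZMod (p ^ w)) ∈ Bzᶜ := Finset.mem_compl.2 hmem
    have hS := hsum h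
    rw [← Finset.add_sum_erase _ _ hin, sub_self, hν0, zero_add] at hS
    have hdv : (p : ℤ) ^ (w + ∑ z ∈ Bzᶜ.erase (h : ZMod (p ^ w)), ν (h - z)) ∣
        ∏ z ∈ Bzᶜ, (h - (z.val : ℤ)) := by
      rw [← Finset.mul_prod_erase _ _ hin, pow_add, ← Finset.prod_pow_eq_pow_sum]
      refine mul_dvd_mul ((hcast _).1 (by rw [hcz, sub_self])) (Finset.prod_dvd_prod_of_dvd _ _ ?_)
      intro z _
      have := nu_dvd p w (h - (z.val : ℤ))
      rwa [hcz] at this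
    obtain ⟨q, hq⟩ := (pow_dvd_pow (p : ℤ) (show (∑ z, ν z) + 1 ≤ _ by omega)).trans hdv
    refine ⟨p * q, by rw [hq]; ring, iff_of_false (by simp) ?_⟩
    rintro ⟨b, hb, hhb⟩
    refine hmem (Finset.mem_image.2 ⟨b, hb, ?_⟩)
    have := (hcast _).2 hhb
    push_cast at this
    exact (sub_eq_zero.1 this).symm

theorem int_main (p : ℕ) [Fact p.Prime] {n r : ℕ} (w : Fin r → ℕ) (hw : ∀ j, 1 ≤ w j)
    (A : Fin n → Finset ℤ) (hA : ∀ i, (A i).Nonempty)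
    (hinj : ∀ i, Set.InjOn (fun a : ℤ => (a : ZMod p)) (A i))
    (B : Fin r → Finset ℤ)
    (hB : ∀ j, ∀ x ∈ B j, ∀ y ∈ B j, x ≠ y → ¬ (p : ℤ) ∣ x - y)
    (F : Fin r → MvPolynomial (Fin n) ℤ) (P : (Fin n → ℤ) → Prop) [DecidablePred P]
    (hP : ∀ x, P x ↔ ∀ j, ∃ b ∈ B j, (p : ℤ) ^ w j ∣ eval x (F j) - b)
    (hne : ∃ x, (∀ i, x i ∈ A i) ∧ P x) :
    ∃ y : Fin n → ℕ, (∀ i, 1 ≤ y i ∧ y i ≤ (A i).card) ∧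
      ∑ i, (A i).card ≤ ∑ i, y i + ∑ j, (p ^ w j - (B j).card) * (F j).totalDegree ∧
      ∏ i, y i ≤ ((Fintype.piFinset A).filter P).card := by
  classical
  have hp : p.Prime := Fact.out
  have hpZ : Prime (p : ℤ) := Nat.prime_iff_prime_int.1 hp
  choose S e hS hq using fun j => detect p (w j) (hw j) (B j) (hB j)
  choose q hq1 hq2 using hq
  obtain ⟨F', hF'⟩ : ∃ F' : MvPolynomial (Fin n) ℤ, F' = ∏ j, ∏ s ∈ S j, (F j - C s) := ⟨_, rfl⟩
  have hev : ∀ x, eval x F' = (p : ℤ) ^ (∑ j, e j) * ∏ j, q j (eval x (F j)) := by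
    intro x
    rw [hF', map_prod, ← Finset.prod_pow_eq_pow_sum, ← Finset.prod_mul_distrib]
    refine Finset.prod_congr rfl fun j _ => ?_
    rw [← hq1, map_prod]
    refine Finset.prod_congr rfl fun s _ => ?_
    rw [map_sub, eval_C]
  have hdeg : F'.totalDegree ≤ ∑ j, (p ^ w j - (B j).card) * (F j).totalDegree := by
    rw [hF']
    refine (totalDegree_finsetProd _ _).trans (Finset.sum_le_sum fun j _ => ?_)
    refine (totalDegree_finsetProd _ _).trans ?_
    rw [← hS, ← smul_eq_mul]
    exact Finset.sum_le_card_nsmul _ _ _ fun s _ => totalDegree_sub_C_le _ _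
  obtain ⟨G, hG1, hG2⟩ := grid_divide p A hA hinj (∑ j, e j) F'
    (fun x _ => ⟨_, hev x⟩)
  have hGP : ∀ x, (∀ i, x i ∈ A i) → (¬ (p : ℤ) ∣ eval x G ↔ P x) := by
    intro x hx
    have h1 := (hG2 x hx).symm.trans (hev x)
    rw [mul_left_cancel₀ (pow_ne_zero _ hpZ.ne_zero) h1, hpZ.dvd_finsetProd_iff, hP]
    simp only [Finset.mem_univ, true_and, not_exists, hq2]
  have hev2 : ∀ x : Fin n → ℤ, eval (fun i => (x i : ZMod p)) (map (Int.castRingHom (ZMod p)) G) ≠ 0 ↔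
      ¬ (p : ℤ) ∣ eval x G := by
    intro x
    rw [eval_map_int, Ne, ZMod.intCast_zmod_eq_zero_iff_dvd]
  have hdegG : (map (Int.castRingHom (ZMod p)) G).totalDegree ≤
      ∑ j, (p ^ w j - (B j).card) * (F j).totalDegree :=
    (Finset.sup_mono (support_map_subset _ _)).trans (hG1.trans hdeg)
  obtain ⟨y, hy1, hy2, hy3⟩ := alon_furedi n _
    (fun i => (A i).image (fun a : ℤ => (a : ZMod p))) (map (Int.castRingHom (ZMod p)) G) hdegG (by
      obtain ⟨x, hx, hPx⟩ := hne
      exact ⟨fun i => (x i : ZMod p), fun i => Finset.mem_image_of_mem _ (hx i),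
        (hev2 x).2 ((hGP x hx).2 hPx)⟩)
  have hc : ∀ i, ((A i).image (fun a : ℤ => (a : ZMod p))).card = (A i).card :=
    fun i => Finset.card_image_of_injOn (hinj i)
  simp only [hc] at hy1 hy2
  refine ⟨y, hy1, hy2, hy3.trans ?_⟩
  refine le_trans (Finset.card_le_card (t := ((Fintype.piFinset A).filter P).image
    (fun x i => (x i : ZMod p))) ?_) Finset.card_image_le
  intro z hz
  simp only [Finset.mem_filter, Fintype.mem_piFinset] at hz
  have : ∀ i, ∃ a ∈ A i, (a : ZMod p) = z i := fun i => by simpa using hz.1 i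
  choose a ha haz using this
  refine Finset.mem_image.2 ⟨a, ?_, funext haz⟩
  rw [Finset.mem_filter, Fintype.mem_piFinset]
  refine ⟨ha, (hGP a ha).1 ((hev2 a).1 ?_)⟩
  rw [funext haz]
  exact hz.2

theorem lower_tuple {n : ℕ} (N : ℕ) (hN : n ≤ N) : ∀ (k : ℕ) (y : Fin n → ℕ), (∀ i, 1 ≤ y i) →
    ∑ i, y i = N + k → ∃ y' : Fin n → ℕ, (∀ i, 1 ≤ y' i ∧ y' i ≤ y i) ∧ ∑ i, y' i = N := by
  intro k
  induction k with
  | zero => exact fun y hy hs => ⟨y, fun i => ⟨hy i, le_rfl⟩, hs⟩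
  | succ k ih =>
    intro y hy hs
    obtain ⟨i, hi⟩ : ∃ i, 1 < y i := by
      by_contra! hcon
      have : ∑ i, y i ≤ ∑ i : Fin n, 1 := Finset.sum_le_sum fun i _ => hcon i
      simp at this
      omega
    have hupd : ∑ j, Function.update y i (y i - 1) j = N + k := by
      rw [Finset.sum_update_of_mem (Finset.mem_univ i)]
      rw [← Finset.add_sum_erase _ _ (Finset.mem_univ i)] at hs
      rw [← Finset.erase_eq]
      omega
    obtain ⟨y', hy', hs'⟩ := ih (Function.update y i (y i - 1)) (fun j => by
      by_cases hj : j = i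
      · subst hj; simp; omega
      · simpa [hj] using hy j) hupd
    refine ⟨y', fun j => ⟨(hy' j).1, (hy' j).2.trans ?_⟩, hs'⟩
    by_cases hj : j = i
    · subst hj; simp
    · simp [hj]

theorem mBound_le {n : ℕ} (a y : Fin n → ℕ) (N : ℕ) (hy : ∀ i, 1 ≤ y i ∧ y i ≤ a i)
    (hN : N ≤ ∑ i, y i) : mBound n a N ≤ ∏ i, y i := by
  unfold mBound
  split_ifs with h
  · have : 0 < ∏ i, y i := Finset.prod_pos fun i _ => (hy i).1
    exact this
  · obtain ⟨y', hy', hs⟩ := lower_tuple N (not_lt.1 h) (∑ i, y i - N) y (fun i => (hy i).1)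
      (by omega)
    refine le_trans (Nat.sInf_le (Set.mem_image_of_mem _
      (show y' ∈ {y : Fin n → ℕ | (∀ i, 1 ≤ y i ∧ y i ≤ a i) ∧ ∑ i, y i = N} from
        ⟨fun i => ⟨(hy' i).1, (hy' i).2.trans (hy i).2⟩, hs⟩))) ?_
    exact Finset.prod_le_prod' fun i _ => (hy' i).2

theorem mem_span_iff (p v k : ℕ) (hk : k ≤ v) (a : ℤ) :
    (a : ZMod (p ^ v)) ∈ Ideal.span {(p : ZMod (p ^ v)) ^ k} ↔ (p : ℤ) ^ k ∣ a := by
  rw [Ideal.mem_span_singleton]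
  constructor
  · rintro ⟨c, hc⟩
    obtain ⟨c, rfl⟩ := ZMod.intCast_surjective c
    have h1 : ((a - (p : ℤ) ^ k * c : ℤ) : ZMod (p ^ v)) = 0 := by
      push_cast; rw [hc, sub_self]
    rw [ZMod.intCast_zmod_eq_zero_iff_dvd, Nat.cast_pow] at h1
    exact (dvd_sub_left (Dvd.intro _ rfl)).1 ((pow_dvd_pow _ hk).trans h1)
  · rintro ⟨c, rfl⟩
    exact ⟨(c : ZMod (p ^ v)), by push_cast; rfl⟩

theorem stmt13 (p : ℕ) (hp : p.Prime) (n r v : ℕ) (hn : 0 < n) (hr : 0 < r)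
    (hv : 0 < v) (w : Fin r → ℕ) (hw : ∀ j, 1 ≤ w j ∧ w j ≤ v)
    (A : Fin n → Finset (ZMod (p ^ v))) (hA : ∀ i, (A i).Nonempty)
    (B : Fin r → Finset (ZMod (p ^ v))) (hB : ∀ j, (B j).Nonempty)
    (hAp : ∀ i, ∀ x ∈ A i, ∀ y ∈ A i, x ≠ y →
      x - y ∉ Ideal.span {(p : ZMod (p ^ v))})
    (hBp : ∀ j, ∀ x ∈ B j, ∀ y ∈ B j, x ≠ y →
      x - y ∉ Ideal.span {(p : ZMod (p ^ v))})
    (f : Fin r → MvPolynomial (Fin n) (ZMod (p ^ v)))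
    (Z : Set (Fin n → ZMod (p ^ v)))
    (hZ : Z = {x | (∀ i, x i ∈ A i) ∧
      ∀ j, ∃ b ∈ B j, eval x (f j) - b ∈ Ideal.span {(p : ZMod (p ^ v)) ^ (w j)}}) :
    Z = ∅ ∨
      mBound n (fun i => (A i).card)
        ((∑ i, (A i).card) - ∑ j, (p ^ (w j) - (B j).card) * (f j).totalDegree)
        ≤ Z.ncard := by
  classical
  rcases Set.eq_empty_or_nonempty Z with hE | ⟨x0, hx0⟩
  · exact Or.inl hE
  right
  have : Fact p.Prime := ⟨hp⟩
  have : NeZero (p ^ v) := ⟨pow_ne_zero _ hp.ne_zero⟩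
  let L : ZMod (p ^ v) → ℤ := fun z => (z.val : ℤ)
  have hL : ∀ z, ((L z : ℤ) : ZMod (p ^ v)) = z := fun z => by simp [L]
  have hLinj : Function.Injective L := fun a b hab => by rw [← hL a, hab, hL]
  have hspan1 : ∀ a : ℤ, (a : ZMod (p ^ v)) ∈ Ideal.span {(p : ZMod (p ^ v))} ↔ (p : ℤ) ∣ a := by
    intro a
    have := mem_span_iff p v 1 hv a
    rwa [pow_one, pow_one] at this
  choose F hF1 hF2 hF3 using fun j => exists_lift (Int.castRingHom (ZMod (p ^ v)))
    ZMod.intCast_surjective (f j)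
  have hmem : ∀ x : Fin n → ℤ, (∀ i, x i ∈ (A i).image L) →
      ∀ i, (x i : ZMod (p ^ v)) ∈ A i := by
    intro x hx i
    obtain ⟨a, ha, hax⟩ := Finset.mem_image.1 (hx i)
    rw [← hax, hL]; exact ha
  have hcond : ∀ (x : Fin n → ℤ) (j : Fin r),
      (∃ b ∈ (B j).image L, (p : ℤ) ^ w j ∣ eval x (F j) - b) ↔
      ∃ b ∈ B j, eval (fun i => (x i : ZMod (p ^ v))) (f j) - b ∈
        Ideal.span {(p : ZMod (p ^ v)) ^ (w j)} := by
    intro x j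
    have h1 := eval_map_int (q := p ^ v) (F j) x
    rw [hF1] at h1
    rw [Finset.exists_mem_image]
    refine exists_congr fun b => and_congr_right fun _ => ?_
    rw [← mem_span_iff p v (w j) (hw j).2, h1, Int.cast_sub, hL]
  obtain ⟨y, hy1, hy2, hy3⟩ := int_main p w (fun j => (hw j).1) (fun i => (A i).image L)
    (fun i => (hA i).image _) (by
      intro i x hx y hy hxy
      obtain ⟨a, ha, rfl⟩ := Finset.mem_image.1 (Finset.mem_coe.1 hx)
      obtain ⟨b, hb, rfl⟩ := Finset.mem_image.1 (Finset.mem_coe.1 hy)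
      by_contra hne
      refine hAp i a ha b hb (fun h => hne (by rw [h])) ?_
      have h2 : ((L a - L b : ℤ) : ZMod (p ^ v)) = a - b := by rw [Int.cast_sub, hL, hL]
      rw [← h2, hspan1, ← ZMod.intCast_zmod_eq_zero_iff_dvd, Int.cast_sub]
      exact sub_eq_zero.2 hxy)
    (fun j => (B j).image L) (by
      intro j x hx y hy hxy
      obtain ⟨a, ha, rfl⟩ := Finset.mem_image.1 hx
      obtain ⟨b, hb, rfl⟩ := Finset.mem_image.1 hy
      rw [← hspan1, Int.cast_sub, hL, hL]
      exact hBp j a ha b hb (fun h => hxy (by rw [h])))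
    F (fun x => ∀ j, ∃ b ∈ B j, eval (fun i => (x i : ZMod (p ^ v))) (f j) - b ∈
        Ideal.span {(p : ZMod (p ^ v)) ^ (w j)})
    (fun x => forall_congr' fun j => (hcond x j).symm) (by
      rw [hZ] at hx0
      refine ⟨fun i => L (x0 i), fun i => Finset.mem_image_of_mem _ (hx0.1 i), ?_⟩
      simp only [hL]
      exact hx0.2)
  simp only [Finset.card_image_of_injective _ hLinj] at hy1 hy2
  have hdeg : ∑ j, (p ^ w j - (B j).card) * (F j).totalDegree ≤
      ∑ j, (p ^ w j - (B j).card) * (f j).totalDegree :=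
    Finset.sum_le_sum fun j _ => Nat.mul_le_mul_left _ (hF2 j)
  refine (mBound_le _ y _ hy1 (by omega)).trans (hy3.trans ?_)
  rw [← Set.ncard_coe_finset]
  refine Set.ncard_le_ncard_of_injOn (fun x i => (x i : ZMod (p ^ v))) ?_ ?_ (Set.toFinite Z)
  · intro x hx
    rw [Finset.mem_coe, Finset.mem_filter, Fintype.mem_piFinset] at hx
    rw [hZ]
    exact ⟨hmem x hx.1, hx.2⟩
  · intro x hx x' hx' hxx
    rw [Finset.mem_coe, Finset.mem_filter, Fintype.mem_piFinset] at hx hx'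
    funext i
    obtain ⟨a, ha, hax⟩ := Finset.mem_image.1 (hx.1 i)
    obtain ⟨b, hb, hbx⟩ := Finset.mem_image.1 (hx'.1 i)
    have h3 := congrFun hxx i
    simp only [← hax, ← hbx, hL] at h3
    rw [← hax, ← hbx, h3]
end

section
/- (Restricted-variable, restricted-output nonuniqueness, Corollary of Main Theorem) Let p be a prime, v ≥ 1, 1 ≤ v_j ≤ v, B_1,...,B_r ⊂ Z/p^vZ nonempty with no two distinct elements congruent mod p, and f_1,...,f_r ∈ (Z/p^vZ)[t_1,...,t_n] with f_j(0) = 0 and 0 ∈ B_j for all j. If n > Σ_{j=1}^r (p^{v_j} - #B_j)·deg f_j, then there exists a nonzero x ∈ {0,1}^n such that f_j(x) ∈ B_j (mod p^{v_j}) for all j. -/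
open MvPolynomial

/-- The `p`-adic valuation of the standard representative, with value `0` at `0`. -/
noncomputable def vz (p : ℕ) {k : ℕ} (a : ZMod k) : ℕ := padicValNat p a.val

lemma vz_zero (p k : ℕ) : vz p (0 : ZMod k) = 0 := by
  simp [vz]

lemma vz_lt {p w : ℕ} (hp : p.Prime) (hw : 1 ≤ w) (a : ZMod (p ^ w)) : vz p a < w := by
  have := Fact.mk hp
  have : NeZero (p ^ w) := ⟨pow_ne_zero _ hp.ne_zero⟩
  by_cases ha : a = 0
  · subst ha; rw [vz_zero]; omega
  · have h1 : a.val ≠ 0 := by rwa [Ne, ZMod.val_eq_zero]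
    have h2 : p ^ (vz p a) ∣ a.val := pow_padicValNat_dvd
    have h3 := Nat.le_of_dvd (Nat.pos_of_ne_zero h1) h2
    exact (Nat.pow_lt_pow_iff_right hp.one_lt).1 (h3.trans_lt (ZMod.val_lt a))

lemma cast_of_vz_pos {p w : ℕ} (hp : p.Prime) (hw : 1 ≤ w) (a : ZMod (p ^ w))
    (ha : vz p a ≠ 0) :
    ZMod.castHom (dvd_pow_self p (by omega : w ≠ 0)) (ZMod p) a = 0 := by
  have := Fact.mk hp
  have : NeZero (p ^ w) := ⟨pow_ne_zero _ hp.ne_zero⟩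
  have h : p ∣ a.val := by
    by_contra h
    exact ha (padicValNat.eq_zero_of_not_dvd h)
  have h2 : ((a.val : ℕ) : ZMod p) = 0 := (ZMod.natCast_eq_zero_iff _ _).2 h
  rw [← h2, ← map_natCast (ZMod.castHom (dvd_pow_self p (by omega : w ≠ 0)) (ZMod p)),
    ZMod.natCast_zmod_val]

lemma emult_eq {p w : ℕ} (hp : p.Prime) (hw : 1 ≤ w) (z : ℤ)
    (hz : (z : ZMod (p ^ w)) ≠ 0) :
    emultiplicity (p : ℤ) z = vz p (z : ZMod (p ^ w)) := by
  have := Fact.mk hp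
  have : NeZero (p ^ w) := ⟨pow_ne_zero _ hp.ne_zero⟩
  set a := (z : ZMod (p ^ w)) with ha
  have hd : ((p : ℤ) ^ w) ∣ z - a.val := by
    have : ((z - a.val : ℤ) : ZMod (p ^ w)) = 0 := by
      push_cast; rw [ZMod.natCast_zmod_val, ← ha, sub_self]
    have := (ZMod.intCast_zmod_eq_zero_iff_dvd _ _).1 this
    exact_mod_cast this
  have hlt := vz_lt hp hw a
  have h1 : a.val ≠ 0 := by rwa [Ne, ZMod.val_eq_zero]
  have hiff : ∀ m ≤ w, ((p : ℤ) ^ m ∣ z ↔ p ^ m ∣ a.val) := by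
    intro m hm
    have h2 : (p : ℤ) ^ m ∣ z - a.val := (pow_dvd_pow _ hm).trans hd
    rw [← Int.natCast_dvd_natCast]
    push_cast
    constructor
    · intro h; simpa using dvd_sub h h2
    · intro h; simpa using dvd_add h h2
  rw [emultiplicity_eq_coe]
  refine ⟨(hiff _ hlt.le).2 pow_padicValNat_dvd, ?_⟩
  rw [hiff _ hlt]
  exact pow_succ_padicValNat_not_dvd h1

lemma le_emult {p w : ℕ} (hp : p.Prime) (hw : 1 ≤ w) (z : ℤ) :
    (vz p (z : ZMod (p ^ w)) : ℕ∞) ≤ emultiplicity (p : ℤ) z := by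
  by_cases hz : (z : ZMod (p ^ w)) = 0
  · rw [hz, vz_zero]; simp
  · exact (emult_eq hp hw z hz).ge

/-- The integer product over the complement of `B`. -/
noncomputable def gz {k : ℕ} [NeZero k] (B : Finset (ZMod k)) (t : ℤ) : ℤ :=
  ∏ s ∈ Bᶜ, (t - s.val)

lemma sum_vz {p w : ℕ} [NeZero (p ^ w)] (B : Finset (ZMod (p ^ w))) (t : ZMod (p ^ w)) :
    ∑ s ∈ Bᶜ, vz p (t - s) + ∑ s ∈ B, vz p (t - s) = ∑ s : ZMod (p ^ w), vz p s := by
  rw [Finset.sum_compl_add_sum]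
  exact (Equiv.subLeft t).sum_comp (fun s => vz p s)

lemma gz_mem {p w : ℕ} (hp : p.Prime) (hw : 1 ≤ w) [NeZero (p ^ w)]
    (B : Finset (ZMod (p ^ w)))
    (hB : Set.InjOn (ZMod.castHom (dvd_pow_self p (by omega : w ≠ 0)) (ZMod p)) B)
    (t : ℤ) (ht : (t : ZMod (p ^ w)) ∈ B) :
    emultiplicity (p : ℤ) (gz B t) = (∑ s : ZMod (p ^ w), vz p s : ℕ) := by
  have h0 : ∑ s ∈ B, vz p ((t : ZMod (p ^ w)) - s) = 0 := by
    refine Finset.sum_eq_zero fun s hs => ?_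
    by_contra h
    have h2 := cast_of_vz_pos hp hw _ h
    rw [map_sub, sub_eq_zero] at h2
    have := hB ht hs h2
    rw [this, sub_self, vz_zero] at h
    exact h rfl
  rw [← sum_vz B t, h0, add_zero, gz, Finset.emultiplicity_prod (Nat.prime_iff_prime_int.1 hp)]
  push_cast
  refine Finset.sum_congr rfl fun s hs => ?_
  rw [emult_eq hp hw]
  · push_cast; rw [ZMod.natCast_zmod_val]
  · push_cast; rw [ZMod.natCast_zmod_val, sub_ne_zero]
    rintro rfl
    exact (Finset.mem_compl.1 hs) ht

lemma gz_notMem {p w : ℕ} (hp : p.Prime) (hw : 1 ≤ w) [NeZero (p ^ w)]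
    (B : Finset (ZMod (p ^ w)))
    (hB : Set.InjOn (ZMod.castHom (dvd_pow_self p (by omega : w ≠ 0)) (ZMod p)) B)
    (t : ℤ) (ht : (t : ZMod (p ^ w)) ∉ B) :
    ((∑ s : ZMod (p ^ w), vz p s : ℕ) : ℕ∞) + 1 ≤ emultiplicity (p : ℤ) (gz B t) := by
  set a := (t : ZMod (p ^ w)) with ha
  have h0 : ∑ s ∈ B, vz p (a - s) < w := by
    by_cases h : ∃ b ∈ B, vz p (a - b) ≠ 0
    · obtain ⟨b, hb, hb0⟩ := h
      rw [Finset.sum_eq_single_of_mem b hb]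
      · exact vz_lt hp hw _
      · intro c hc hcb
        by_contra h
        have h2 := cast_of_vz_pos hp hw _ h
        have h3 := cast_of_vz_pos hp hw _ hb0
        rw [map_sub, sub_eq_zero] at h2 h3
        exact hcb (hB hc hb (h2.symm.trans h3))
    · push Not at h
      rw [Finset.sum_eq_zero h]; omega
  have hac : a ∈ Bᶜ := Finset.mem_compl.2 ht
  have h1 := sum_vz B a
  rw [← Finset.add_sum_erase _ _ hac, sub_self, vz_zero, zero_add] at h1
  rw [gz, Finset.emultiplicity_prod (Nat.prime_iff_prime_int.1 hp),
    ← Finset.add_sum_erase _ _ hac]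
  have h2 : (w : ℕ∞) ≤ emultiplicity (p : ℤ) (t - a.val) := by
    apply le_emultiplicity_of_pow_dvd
    have : ((t - a.val : ℤ) : ZMod (p ^ w)) = 0 := by
      push_cast; rw [ZMod.natCast_zmod_val, ← ha, sub_self]
    have := (ZMod.intCast_zmod_eq_zero_iff_dvd _ _).1 this
    exact_mod_cast this
  have h3 : ((∑ s ∈ Bᶜ.erase a, vz p (a - s) : ℕ) : ℕ∞) ≤
      ∑ s ∈ Bᶜ.erase a, emultiplicity (p : ℤ) (t - s.val) := by
    push_cast
    refine Finset.sum_le_sum fun s hs => ?_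
    have := le_emult hp hw (t - s.val)
    push_cast at this
    rwa [ZMod.natCast_zmod_val, ← ha] at this
  refine le_trans ?_ (add_le_add h2 h3)
  norm_cast
  omega

lemma alt_sum {n : ℕ} (P : MvPolynomial (Fin n) ℤ) (hP : P.totalDegree < n) :
    ∑ x : Fin n → Fin 2, (∏ i, (-1 : ℤ) ^ (x i : ℕ)) *
      eval (fun i => ((x i : ℕ) : ℤ)) P = 0 := by
  simp_rw [eval_eq', Finset.mul_sum]
  rw [Finset.sum_comm]
  refine Finset.sum_eq_zero fun m hm => ?_
  have hex : ∃ i, m i = 0 := by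
    by_contra! h
    have h1 : m.sum (fun _ e => e) ≤ P.totalDegree := le_totalDegree hm
    rw [Finsupp.sum_fintype _ _ (fun _ => rfl)] at h1
    have h2 : ∑ i : Fin n, 1 ≤ ∑ i, m i :=
      Finset.sum_le_sum fun i _ => Nat.one_le_iff_ne_zero.2 (h i)
    simp at h2
    omega
  obtain ⟨i, hi⟩ := hex
  have key : ∏ i, ∑ a : Fin 2, ((-1 : ℤ) ^ (a : ℕ) * ((a : ℕ) : ℤ) ^ m i) = 0 :=
    Finset.prod_eq_zero (Finset.mem_univ i) (by simp [hi])
  rw [Finset.prod_univ_sum, Fintype.piFinset_univ] at key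
  calc _ = ∑ x : Fin n → Fin 2, coeff m P *
      ∏ i, ((-1 : ℤ) ^ (x i : ℕ) * ((x i : ℕ) : ℤ) ^ m i) := by
        refine Finset.sum_congr rfl fun x _ => ?_
        rw [Finset.prod_mul_distrib]; ring
    _ = 0 := by rw [← Finset.mul_sum, key, mul_zero]

lemma exists_lift_s14 {n k : ℕ} [NeZero k] (f : MvPolynomial (Fin n) (ZMod k)) :
    ∃ F : MvPolynomial (Fin n) ℤ, map (Int.castRingHom (ZMod k)) F = f ∧
      F.totalDegree ≤ f.totalDegree := by
  refine ⟨∑ m ∈ f.support, monomial m ((coeff m f).val : ℤ), ?_, ?_⟩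
  · rw [map_sum]
    conv_rhs => rw [f.as_sum]
    refine Finset.sum_congr rfl fun m _ => ?_
    rw [map_monomial]
    simp
  · refine totalDegree_finsetSum_le fun m hm => ?_
    exact (totalDegree_monomial_le _ _).trans (le_totalDegree hm)

lemma mem_span_of_cast {p w v : ℕ} (hwv : w ≤ v) [NeZero (p ^ v)] (a : ZMod (p ^ v))
    (h : ZMod.castHom (pow_dvd_pow p hwv) (ZMod (p ^ w)) a = 0) :
    a ∈ Ideal.span {(p : ZMod (p ^ v)) ^ w} := by
  rw [← ZMod.natCast_zmod_val a, map_natCast, ZMod.natCast_eq_zero_iff] at h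
  obtain ⟨c, hc⟩ := h
  rw [← ZMod.natCast_zmod_val a, hc, Ideal.mem_span_singleton]
  push_cast
  exact dvd_mul_right _ _

theorem stmt14 (p : ℕ) (hp : p.Prime) (n r v : ℕ) (hv : 0 < v)
    (w : Fin r → ℕ) (hw : ∀ j, 1 ≤ w j ∧ w j ≤ v)
    (B : Fin r → Finset (ZMod (p ^ v))) (hB : ∀ j, (B j).Nonempty)
    (hBp : ∀ j, ∀ x ∈ B j, ∀ y ∈ B j, x ≠ y →
      x - y ∉ Ideal.span {(p : ZMod (p ^ v))})
    (hB0 : ∀ j, (0 : ZMod (p ^ v)) ∈ B j)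
    (f : Fin r → MvPolynomial (Fin n) (ZMod (p ^ v)))
    (hf0 : ∀ j, eval (0 : Fin n → ZMod (p ^ v)) (f j) = 0)
    (hbig : n > ∑ j, (p ^ (w j) - (B j).card) * (f j).totalDegree) :
    ∃ x : Fin n → ZMod (p ^ v), (∀ i, x i = 0 ∨ x i = 1) ∧ x ≠ 0 ∧
      ∀ j, ∃ b ∈ B j, eval x (f j) - b ∈ Ideal.span {(p : ZMod (p ^ v)) ^ (w j)} := by
  classical
  by_contra! hcon
  have hnz : ∀ u, NeZero (p ^ u) := fun u => ⟨pow_ne_zero _ hp.ne_zero⟩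
  have : Fact (1 < p ^ v) := ⟨Nat.one_lt_pow hv.ne' hp.one_lt⟩
  choose F hF hFd using fun j => exists_lift_s14 (f j)
  -- reductions
  let φ : ∀ j, ZMod (p ^ v) →+* ZMod (p ^ w j) :=
    fun j => ZMod.castHom (pow_dvd_pow p (hw j).2) (ZMod (p ^ w j))
  let C : ∀ j, Finset (ZMod (p ^ w j)) := fun j => (B j).image (φ j)
  have hinj : ∀ j, ∀ x ∈ B j, ∀ y ∈ B j,
      ZMod.castHom (dvd_pow_self p (by have := (hw j).1; omega : w j ≠ 0)) (ZMod p) (φ j x) =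
      ZMod.castHom (dvd_pow_self p (by have := (hw j).1; omega : w j ≠ 0)) (ZMod p) (φ j y) →
      x = y := by
    intro j x hx y hy hxy
    by_contra hne
    apply hBp j x hx y hy hne
    rw [← sub_eq_zero, ← map_sub, ← map_sub] at hxy
    generalize x - y = a at hxy
    rw [← ZMod.natCast_zmod_val a, map_natCast, map_natCast, ZMod.natCast_eq_zero_iff] at hxy
    obtain ⟨c, hc⟩ := hxy
    rw [← ZMod.natCast_zmod_val a, hc, Ideal.mem_span_singleton]
    push_cast
    exact dvd_mul_right _ _
  have hCinj : ∀ j, Set.InjOn (ZMod.castHom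
      (dvd_pow_self p (by have := (hw j).1; omega : w j ≠ 0)) (ZMod p)) (C j : Set _) := by
    intro j a ha b hb hab
    obtain ⟨x, hx, rfl⟩ := Finset.mem_image.1 (Finset.mem_coe.1 ha)
    obtain ⟨y, hy, rfl⟩ := Finset.mem_image.1 (Finset.mem_coe.1 hb)
    rw [hinj j x hx y hy hab]
  have hCcard : ∀ j, (C j)ᶜ.card = p ^ w j - (B j).card := by
    intro j
    rw [Finset.card_compl, ZMod.card, Finset.card_image_of_injOn]
    intro x hx y hy hxy
    exact hinj j x hx y hy (by rw [hxy])
  let P : MvPolynomial (Fin n) ℤ := ∏ j, ∏ s ∈ (C j)ᶜ, (F j - MvPolynomial.C (s.val : ℤ))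
  have hPe : ∀ y : Fin n → ℤ, eval y P = ∏ j, gz (C j) (eval y (F j)) := by
    intro y
    simp only [P, gz, map_prod, map_sub, eval_C]
  have hPd : P.totalDegree < n := by
    refine lt_of_le_of_lt ?_ hbig
    refine (totalDegree_finsetProd _ _).trans (Finset.sum_le_sum fun j _ => ?_)
    refine (totalDegree_finsetProd _ _).trans ?_
    rw [← hCcard, ← smul_eq_mul]
    refine Finset.sum_le_card_nsmul _ _ _ fun s _ => ?_
    refine (totalDegree_sub _ _).trans ?_
    rw [totalDegree_C]
    exact max_le (hFd j) (Nat.zero_le _)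
  have hev : ∀ j (y : Fin n → ℤ), eval (fun i => ((y i : ℤ) : ZMod (p ^ v))) (f j) =
      ((eval y (F j) : ℤ) : ZMod (p ^ v)) := by
    intro j y
    rw [← hF j, eval_map]
    exact (eval₂_comp_left (Int.castRingHom (ZMod (p ^ v))) (RingHom.id ℤ) y (F j)).symm
  have hev2 : ∀ j (y : Fin n → ℤ), ((eval y (F j) : ℤ) : ZMod (p ^ w j)) =
      φ j (eval (fun i => ((y i : ℤ) : ZMod (p ^ v))) (f j)) := by
    intro j y
    rw [hev, map_intCast]
  let M : Fin r → ℕ := fun j => ∑ s : ZMod (p ^ w j), vz p s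
  have hprime := Nat.prime_iff_prime_int.1 hp
  have h0 : emultiplicity (p : ℤ) (eval (fun i => (((0 : Fin n → Fin 2) i : ℕ) : ℤ)) P) =
      (∑ j, M j : ℕ) := by
    rw [hPe, Finset.emultiplicity_prod hprime]
    push_cast
    refine Finset.sum_congr rfl fun j _ => ?_
    have := gz_mem hp (hw j).1 (C j) (hCinj j)
      (eval (fun i => (((0 : Fin n → Fin 2) i : ℕ) : ℤ)) (F j)) (by
        rw [hev2]
        have h : (fun i => (((((0 : Fin n → Fin 2) i : ℕ) : ℤ)) : ZMod (p ^ v))) =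
          (0 : Fin n → ZMod (p ^ v)) := by ext i; simp
        rw [h, hf0]
        exact Finset.mem_image_of_mem _ (hB0 j))
    simpa [M] using this
  have hx : ∀ x : Fin n → Fin 2, x ≠ 0 →
      (p : ℤ) ^ (∑ j, M j + 1) ∣ eval (fun i => ((x i : ℕ) : ℤ)) P := by
    intro x hx
    obtain ⟨j₀, hj₀⟩ := hcon (fun i => (((x i : ℕ) : ℤ) : ZMod (p ^ v))) (by
        intro i
        generalize x i = a
        fin_cases a <;> simp) (by
        intro h
        apply hx
        ext i
        have h2 := congrFun h i
        revert h2
        generalize x i = a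
        fin_cases a <;> simp)
    apply pow_dvd_of_le_emultiplicity
    rw [hPe, Finset.emultiplicity_prod hprime]
    have hnot : ((eval (fun i => ((x i : ℕ) : ℤ)) (F j₀) : ℤ) : ZMod (p ^ w j₀)) ∉ C j₀ := by
      rw [hev2]
      intro hm
      obtain ⟨b, hb, hbe⟩ := Finset.mem_image.1 hm
      refine hj₀ b hb (mem_span_of_cast (hw j₀).2 _ ?_)
      rw [map_sub, sub_eq_zero]
      exact hbe.symm
    have hle : ∀ j, (M j : ℕ∞) ≤
        emultiplicity (p : ℤ) (gz (C j) (eval (fun i => ((x i : ℕ) : ℤ)) (F j))) := by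
      intro j
      by_cases h : ((eval (fun i => ((x i : ℕ) : ℤ)) (F j) : ℤ) : ZMod (p ^ w j)) ∈ C j
      · exact (gz_mem hp (hw j).1 (C j) (hCinj j) _ h).ge
      · exact le_self_add.trans (gz_notMem hp (hw j).1 (C j) (hCinj j) _ h)
    have hlt := gz_notMem hp (hw j₀).1 (C j₀) (hCinj j₀) _ hnot
    rw [← Finset.add_sum_erase _ _ (Finset.mem_univ j₀),
      ← Finset.add_sum_erase _ _ (Finset.mem_univ j₀)]
    refine le_trans ?_ (add_le_add hlt (Finset.sum_le_sum fun j _ => hle j))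
    apply le_of_eq
    push_cast
    simp only [M]
    push_cast
    ring
  have halt := alt_sum P hPd
  rw [← Finset.add_sum_erase _ _ (Finset.mem_univ (0 : Fin n → Fin 2))] at halt
  have hd : (p : ℤ) ^ (∑ j, M j + 1) ∣
      eval (fun i => (((0 : Fin n → Fin 2) i : ℕ) : ℤ)) P := by
    have h1 : (p : ℤ) ^ (∑ j, M j + 1) ∣ ∑ x ∈ (Finset.univ : Finset (Fin n → Fin 2)).erase 0,
        (∏ i, (-1 : ℤ) ^ (x i : ℕ)) * eval (fun i => ((x i : ℕ) : ℤ)) P :=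
      Finset.dvd_sum fun x hxm => Dvd.dvd.mul_left (hx x (Finset.ne_of_mem_erase hxm)) _
    have h2 := eq_neg_of_add_eq_zero_left halt
    have h3 : (∏ i, (-1 : ℤ) ^ ((0 : Fin n → Fin 2) i : ℕ)) = 1 := by simp
    rw [h3, one_mul] at h2
    rw [h2]
    exact (dvd_neg).2 h1
  exact (emultiplicity_eq_coe.1 h0).2 hd
end

section
/- (Weighted fat Davenport bound for p-groups) Let p be a prime, 1 ≤ v_1 ≤ ... ≤ v_r, and G = ⊕_{j=1}^r Z/p^{v_j}Z. Let A_1,...,A_n ⊂ Z/p^{v_r}Z and B_j ⊂ Z/p^{v_j}Z (1 ≤ j ≤ r) each be nonempty with no two distinct elements congruent modulo p, and suppose 0 ∈ A_i for all i and 0 ∈ B_j for all j. If Σ_{i=1}^n (#A_i - 1) > Σ_{j=1}^r (p^{v_j} - #B_j), then for every sequence g_1,...,g_n in G there exist a_i ∈ A_i, not all zero, such that the j-th coordinate of Σ_i a_i g_i lies in B_j for all j. -/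
open Finset in
lemma aux_norm_congr (p k : ℕ) [Fact p.Prime] (x y : ℤ)
    (hxy : (x : ZMod (p ^ k)) = y) (hy : (y : ZMod (p ^ k)) ≠ 0) :
    ‖(x : ℚ_[p])‖ = ‖(y : ℚ_[p])‖ := by
  have h1 : ‖((x - y : ℤ) : ℚ_[p])‖ ≤ (p : ℝ) ^ (-k : ℤ) := by
    rw [Padic.norm_int_le_pow_iff_dvd]
    have := (ZMod.intCast_zmod_eq_zero_iff_dvd (x - y) (p ^ k)).1 (by push_cast; rw [hxy, sub_self])
    exact_mod_cast this
  have h2 : ¬ ‖(y : ℚ_[p])‖ ≤ (p : ℝ) ^ (-k : ℤ) := by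
    rw [Padic.norm_int_le_pow_iff_dvd]
    intro h
    exact hy ((ZMod.intCast_zmod_eq_zero_iff_dvd y (p ^ k)).2 (by exact_mod_cast h))
  apply Padic.norm_eq_of_norm_sub_lt_right
  push_cast at h1
  exact lt_of_le_of_lt h1 (not_le.1 h2)

lemma aux_norm_one (p k : ℕ) [Fact p.Prime] (x : ℤ)
    (hx : (x : ZMod (p ^ k)) ∉ Ideal.span {(p : ZMod (p ^ k))}) :
    ‖(x : ℚ_[p])‖ = 1 := by
  refine le_antisymm (Padic.norm_int_le_one x) ?_
  by_contra h
  rw [not_le] at h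
  have h3 := Padic.norm_intCast_lt_one_iff.1 h
  apply hx
  rw [Ideal.mem_span_singleton]
  obtain ⟨m, rfl⟩ := h3
  exact ⟨(m : ZMod (p ^ k)), by push_cast; rfl⟩

open Finset in
lemma aux_key (p k : ℕ) [Fact p.Prime] (hk : 1 ≤ k) (B : Finset (ZMod (p ^ k)))
    (hBp : ∀ x ∈ B, ∀ y ∈ B, x ≠ y → x - y ∉ Ideal.span {(p : ZMod (p ^ k))}) :
    ∃ N : ℝ, 0 < N ∧ ∀ x : ℤ,
      (((x : ZMod (p ^ k)) ∈ B → ‖∏ c ∈ Bᶜ, ((x : ℚ_[p]) - (c.val : ℚ_[p]))‖ = N) ∧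
       ((x : ZMod (p ^ k)) ∉ B → ‖∏ c ∈ Bᶜ, ((x : ℚ_[p]) - (c.val : ℚ_[p]))‖ < N)) := by
  have hp : p.Prime := Fact.out
  set ν : ZMod (p ^ k) → ℝ := fun z => ‖((z.val : ℤ) : ℚ_[p])‖ with hν
  have hcast : ∀ z : ZMod (p ^ k), (((z.val : ℤ)) : ZMod (p ^ k)) = z := by
    intro z; simp
  have hνx : ∀ (x : ℤ) (c : ZMod (p ^ k)), (x : ZMod (p ^ k)) ≠ c →
      ‖(x : ℚ_[p]) - (c.val : ℚ_[p])‖ = ν ((x : ZMod (p ^ k)) - c) := by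
    intro x c hxc
    have := aux_norm_congr p k (x - c.val) (((x : ZMod (p ^ k)) - c).val : ℤ)
      (by rw [hcast]; push_cast; simp) (by rw [hcast]; exact sub_ne_zero.2 hxc)
    rw [hν]; simp only; rw [← this]; push_cast; rfl
  have hνpos : ∀ z, z ≠ 0 → (p : ℝ) ^ (-k : ℤ) < ν z := by
    intro z hz
    rw [← not_le, hν]
    simp only
    rw [Padic.norm_int_le_pow_iff_dvd]
    intro h
    apply hz
    rw [← hcast z]
    exact (ZMod.intCast_zmod_eq_zero_iff_dvd _ (p ^ k)).2 (by exact_mod_cast h)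
  have hp0 : (0 : ℝ) < (p : ℝ) ^ (-k : ℤ) := by
    have : (0 : ℝ) < p := by exact_mod_cast hp.pos
    positivity
  have hpk1 : (p : ℝ) ^ (-k : ℤ) < 1 := by
    apply zpow_lt_one_of_neg₀
    · exact_mod_cast hp.one_lt
    · omega
  have hν1 : ∀ z, z ∉ Ideal.span {(p : ZMod (p ^ k))} → ν z = 1 := by
    intro z hz
    exact aux_norm_one p k _ (by rw [hcast]; exact hz)
  have hreindex : ∀ x : ZMod (p ^ k), ∏ c ∈ univ.erase x, ν (x - c) = ∏ z ∈ univ.erase 0, ν z := by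
    intro x
    refine Finset.prod_nbij' (fun c => x - c) (fun c => x - c) ?_ ?_ ?_ ?_ ?_
    · intro c hc
      simp only [mem_erase, mem_univ, and_true] at hc ⊢
      exact sub_ne_zero.2 (Ne.symm hc)
    · intro c hc
      simp only [mem_erase, mem_univ, and_true] at hc ⊢
      simpa using hc
    · intro c _; simp
    · intro c _; simp
    · intro c _; rfl
  refine ⟨∏ z ∈ univ.erase 0, ν z, ?_, ?_⟩
  · apply Finset.prod_pos
    intro z hz
    exact hp0.trans (hνpos z (Finset.ne_of_mem_erase hz))
  intro x
  rw [← hreindex (x : ZMod (p ^ k))]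
  constructor
  · intro hx
    have hsplit : univ.erase (x : ZMod (p ^ k)) = Bᶜ ∪ B.erase (x : ZMod (p ^ k)) := by
      ext c
      simp only [mem_erase, mem_univ, and_true, mem_union, mem_compl]
      constructor
      · intro h
        by_cases hc : c ∈ B
        · exact Or.inr ⟨h, hc⟩
        · exact Or.inl hc
      · rintro (h | h)
        · rintro rfl; exact h hx
        · exact h.1
    have hdisj : Disjoint Bᶜ (B.erase (x : ZMod (p ^ k))) := by
      rw [Finset.disjoint_left]
      intro c hc hc'
      exact (mem_compl.1 hc) (mem_of_mem_erase hc')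
    rw [hsplit, Finset.prod_union hdisj]
    have h1 : ∏ c ∈ B.erase (x : ZMod (p ^ k)), ν ((x : ZMod (p ^ k)) - c) = 1 := by
      apply Finset.prod_eq_one
      intro c hc
      exact hν1 _ (hBp _ hx _ (mem_of_mem_erase hc) (Ne.symm (ne_of_mem_erase hc)))
    rw [h1, mul_one, norm_prod]
    apply Finset.prod_congr rfl
    intro c hc
    apply hνx
    rintro rfl
    exact (mem_compl.1 hc) hx
  · intro hx
    have hsplit : univ.erase (x : ZMod (p ^ k)) = Bᶜ.erase (x : ZMod (p ^ k)) ∪ B := by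
      ext c
      simp only [mem_erase, mem_univ, and_true, mem_union, mem_compl]
      constructor
      · intro h
        by_cases hc : c ∈ B
        · exact Or.inr hc
        · exact Or.inl ⟨h, hc⟩
      · rintro (h | h)
        · exact h.1
        · rintro rfl; exact hx h
    have hdisj : Disjoint (Bᶜ.erase (x : ZMod (p ^ k))) B := by
      rw [Finset.disjoint_left]
      intro c hc hc'
      exact (mem_compl.1 (mem_of_mem_erase hc)) hc'
    rw [hsplit, Finset.prod_union hdisj, norm_prod,
      ← Finset.mul_prod_erase Bᶜ _ (mem_compl.2 hx), mul_comm]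
    have h1 : ∏ c ∈ Bᶜ.erase (x : ZMod (p ^ k)), ‖(x : ℚ_[p]) - (c.val : ℚ_[p])‖
        = ∏ c ∈ Bᶜ.erase (x : ZMod (p ^ k)), ν ((x : ZMod (p ^ k)) - c) := by
      apply Finset.prod_congr rfl
      intro c hc
      exact hνx _ _ (Ne.symm (ne_of_mem_erase hc))
    rw [h1]
    apply mul_lt_mul_of_pos_left
    · have h2 : ‖(x : ℚ_[p]) - ((x : ZMod (p ^ k)).val : ℚ_[p])‖ ≤ (p : ℝ) ^ (-k : ℤ) := by
        have h3 := (Padic.norm_int_le_pow_iff_dvd (p := p) (x - (x : ZMod (p ^ k)).val) k).2 (by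
          have := (ZMod.intCast_zmod_eq_zero_iff_dvd (x - (x : ZMod (p ^ k)).val) (p ^ k)).1
            (by push_cast; simp)
          exact_mod_cast this)
        push_cast at h3
        exact h3
      refine lt_of_le_of_lt h2 ?_
      by_cases hb : ∃ b ∈ B, (x : ZMod (p ^ k)) - b ∈ Ideal.span {(p : ZMod (p ^ k))}
      · obtain ⟨b, hbB, hb⟩ := hb
        rw [← Finset.mul_prod_erase B _ hbB, Finset.prod_eq_one, mul_one]
        · apply hνpos
          rw [sub_ne_zero]
          rintro rfl
          exact hx hbB
        · intro c hc
          apply hν1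
          intro h
          refine hBp c (mem_of_mem_erase hc) b hbB (ne_of_mem_erase hc) ?_
          have := Ideal.sub_mem _ hb h
          simpa using this
      · push Not at hb
        rw [Finset.prod_eq_one]
        · exact hpk1
        · intro c hc
          exact hν1 _ (hb c hc)
    · apply Finset.prod_pos
      intro c hc
      exact hp0.trans (hνpos _ (sub_ne_zero.2 (Ne.symm (ne_of_mem_erase hc))))

open Finset in
lemma aux_lagrange {F ι : Type*} [Field F] [DecidableEq ι] {n : ℕ} (A : Fin n → Finset ι)
    (φ : ι → F) (hφ : ∀ i, Set.InjOn φ (A i)) (P : MvPolynomial (Fin n) F)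
    (hP : P.totalDegree < ∑ i, ((A i).card - 1)) :
    ∑ a ∈ Fintype.piFinset A, MvPolynomial.eval (fun i => φ (a i)) P *
      ∏ i, (∏ b ∈ (A i).erase (a i), (φ (a i) - φ b))⁻¹ = 0 := by
  simp_rw [MvPolynomial.eval_eq', Finset.sum_mul]
  rw [Finset.sum_comm]
  apply Finset.sum_eq_zero
  intro d hd
  have hdeg : ∑ i, d i < ∑ i, ((A i).card - 1) := by
    refine lt_of_le_of_lt ?_ hP
    have := MvPolynomial.le_totalDegree hd
    rwa [Finsupp.sum_fintype _ _ (by simp)] at this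
  obtain ⟨i, -, hi⟩ := Finset.exists_lt_of_sum_lt hdeg
  have huni : ∑ x ∈ A i, (φ x ^ d i) * (∏ b ∈ (A i).erase x, (φ x - φ b))⁻¹ = 0 := by
    have h := Lagrange.coeff_eq_sum (hφ i) (P := (Polynomial.X : Polynomial F) ^ d i) (by
      rw [Polynomial.degree_X_pow]
      exact_mod_cast (by omega : d i < (A i).card))
    rw [Polynomial.coeff_X_pow, if_neg (by omega)] at h
    rw [h]
    apply Finset.sum_congr rfl
    intro x _
    simp [div_eq_mul_inv]
  have : ∀ a : Fin n → ι, P.coeff d * (∏ i, φ (a i) ^ d i) *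
      ∏ i, (∏ b ∈ (A i).erase (a i), (φ (a i) - φ b))⁻¹ =
      P.coeff d * ∏ i, (φ (a i) ^ d i * (∏ b ∈ (A i).erase (a i), (φ (a i) - φ b))⁻¹) := by
    intro a
    rw [Finset.prod_mul_distrib, mul_assoc]
  simp_rw [this]
  rw [← Finset.mul_sum,
    ← Finset.prod_univ_sum A (fun i x => φ x ^ d i * (∏ b ∈ (A i).erase x, (φ x - φ b))⁻¹),
    Finset.prod_eq_zero (Finset.mem_univ i) huni, mul_zero]

theorem stmt19 (p : ℕ) (hp : p.Prime) (r n : ℕ)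
    (v : Fin (r + 1) → ℕ) (hv1 : ∀ j, 1 ≤ v j) (hvmono : Monotone v)
    (A : Fin n → Finset (ZMod (p ^ v (Fin.last r))))
    (B : (j : Fin (r + 1)) → Finset (ZMod (p ^ v j)))
    (hA : ∀ i, (A i).Nonempty) (hB : ∀ j, (B j).Nonempty)
    (hAp : ∀ i, ∀ x ∈ A i, ∀ y ∈ A i, x ≠ y →
      x - y ∉ Ideal.span {(p : ZMod (p ^ v (Fin.last r)))})
    (hBp : ∀ j, ∀ x ∈ B j, ∀ y ∈ B j, x ≠ y →
      x - y ∉ Ideal.span {(p : ZMod (p ^ v j))})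
    (hA0 : ∀ i, (0 : ZMod (p ^ v (Fin.last r))) ∈ A i)
    (hB0 : ∀ j, (0 : ZMod (p ^ v j)) ∈ B j)
    (hbig : ∑ j, (p ^ v j - (B j).card) < ∑ i, ((A i).card - 1))
    (g : Fin n → ((j : Fin (r + 1)) → ZMod (p ^ v j))) :
    ∃ a : Fin n → ZMod (p ^ v (Fin.last r)),
      (∀ i, a i ∈ A i) ∧ a ≠ 0 ∧
      ∀ j, (∑ i, (a i).val • g i) j ∈ B j := by
  classical
  have : Fact p.Prime := ⟨hp⟩
  by_contra hcon
  push Not at hcon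
  choose N hN0 hN using fun j => aux_key p (v j) (hv1 j) (B j) (hBp j)
  let φ : ZMod (p ^ v (Fin.last r)) → ℚ_[p] := fun z => (z.val : ℚ_[p])
  let Lp : Fin (r + 1) → MvPolynomial (Fin n) ℚ_[p] := fun j =>
    ∑ i, MvPolynomial.C ((g i j).val : ℚ_[p]) * MvPolynomial.X i
  let P : MvPolynomial (Fin n) ℚ_[p] :=
    ∏ j, ∏ c ∈ (B j)ᶜ, (Lp j - MvPolynomial.C (c.val : ℚ_[p]))
  have hPdeg : P.totalDegree ≤ ∑ j, (p ^ v j - (B j).card) := by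
    refine (MvPolynomial.totalDegree_finsetProd _ _).trans ?_
    apply Finset.sum_le_sum
    intro j _
    refine (MvPolynomial.totalDegree_finsetProd _ _).trans ?_
    have hc : ((B j)ᶜ).card = p ^ v j - (B j).card := by
      rw [Finset.card_compl, ZMod.card]
    rw [← hc, Finset.card_eq_sum_ones]
    apply Finset.sum_le_sum
    intro c _
    refine (MvPolynomial.totalDegree_sub _ _).trans ?_
    rw [MvPolynomial.totalDegree_C]
    refine max_le ?_ (Nat.zero_le _)
    apply MvPolynomial.totalDegree_finsetSum_le
    intro i _
    refine (MvPolynomial.totalDegree_mul _ _).trans ?_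
    rw [MvPolynomial.totalDegree_C, MvPolynomial.totalDegree_X]
  have hnorm1 : ∀ i, ∀ x ∈ A i, ∀ y ∈ A i, x ≠ y → ‖φ x - φ y‖ = 1 := by
    intro i x hx y hy hxy
    have := aux_norm_one p (v (Fin.last r)) ((x.val : ℤ) - y.val) (by
      push_cast; simpa using hAp i x hx y hy hxy)
    push_cast at this
    exact this
  have hφ : ∀ i, Set.InjOn φ (A i) := by
    intro i x hx y hy hxy
    by_contra hne
    have := hnorm1 i x hx y hy hne
    rw [hxy, sub_self, norm_zero] at this
    exact zero_ne_one this
  have hsum := aux_lagrange A φ hφ P (lt_of_le_of_lt hPdeg hbig)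
  have hW : ∀ a ∈ Fintype.piFinset A,
      ‖∏ i, (∏ b ∈ (A i).erase (a i), (φ (a i) - φ b))⁻¹‖ = 1 := by
    intro a ha
    rw [norm_prod]
    apply Finset.prod_eq_one
    intro i _
    rw [norm_inv, norm_prod, Finset.prod_eq_one, inv_one]
    intro b hb
    exact hnorm1 i _ (Fintype.mem_piFinset.1 ha i) _ (Finset.mem_of_mem_erase hb)
      (Ne.symm (Finset.ne_of_mem_erase hb))
  let L : (Fin n → ZMod (p ^ v (Fin.last r))) → Fin (r + 1) → ℤ := fun a j =>
    ∑ i, ((a i).val : ℤ) * ((g i j).val : ℤ)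
  have hLcast : ∀ a j, ((L a j : ℤ) : ZMod (p ^ v j)) = (∑ i, (a i).val • g i) j := by
    intro a j
    rw [Finset.sum_apply]
    simp only [L, Int.cast_sum, Int.cast_mul, Int.cast_natCast, Pi.smul_apply, nsmul_eq_mul,
      ZMod.natCast_zmod_val]
  have hPeval : ∀ a, MvPolynomial.eval (fun i => φ (a i)) P =
      ∏ j, ∏ c ∈ (B j)ᶜ, ((L a j : ℚ_[p]) - (c.val : ℚ_[p])) := by
    intro a
    simp only [P, Lp, L, φ, map_prod, map_sub, map_sum, map_mul, MvPolynomial.eval_C,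
      MvPolynomial.eval_X, Int.cast_sum, Int.cast_mul, Int.cast_natCast]
    refine Finset.prod_congr rfl fun j _ => Finset.prod_congr rfl fun c _ => ?_
    congr 1
    exact Finset.sum_congr rfl fun i _ => mul_comm _ _
  have h0mem : (0 : Fin n → ZMod (p ^ v (Fin.last r))) ∈ Fintype.piFinset A :=
    Fintype.mem_piFinset.2 hA0
  have hNpos : 0 < ∏ j, N j := Finset.prod_pos fun j _ => hN0 j
  have hP0 : ‖MvPolynomial.eval (fun i => φ ((0 : Fin n → ZMod (p ^ v (Fin.last r))) i)) P‖
      = ∏ j, N j := by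
    rw [hPeval, norm_prod]
    refine Finset.prod_congr rfl fun j _ => ?_
    apply (hN j _).1
    rw [hLcast]
    simpa using hB0 j
  have hPa : ∀ a ∈ Fintype.piFinset A, a ≠ 0 →
      ‖MvPolynomial.eval (fun i => φ (a i)) P‖ < ∏ j, N j := by
    intro a ha ha0
    obtain ⟨j, hj⟩ := hcon a (Fintype.mem_piFinset.1 ha) ha0
    rw [hPeval, norm_prod, ← Finset.mul_prod_erase _ _ (Finset.mem_univ j),
      ← Finset.mul_prod_erase _ N (Finset.mem_univ j)]
    refine mul_lt_mul_of_lt_of_le_of_nonneg_of_pos ((hN j _).2 (by rw [hLcast]; exact hj)) ?_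
      (norm_nonneg _) (Finset.prod_pos fun k _ => hN0 k)
    refine Finset.prod_le_prod (fun _ _ => norm_nonneg _) fun k _ => ?_
    by_cases hk : ((L a k : ℤ) : ZMod (p ^ v k)) ∈ B k
    · exact ((hN k _).1 hk).le
    · exact ((hN k _).2 hk).le
  rw [← Finset.add_sum_erase _ _ h0mem] at hsum
  have hrest : ‖∑ a ∈ (Fintype.piFinset A).erase 0, MvPolynomial.eval (fun i => φ (a i)) P *
      ∏ i, (∏ b ∈ (A i).erase (a i), (φ (a i) - φ b))⁻¹‖ < ∏ j, N j := by
    refine Finset.sum_induction _ (fun z : ℚ_[p] => ‖z‖ < ∏ j, N j) ?_ (by simpa using hNpos) ?_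
    · intro x y hx hy
      exact (Padic.nonarchimedean x y).trans_lt (max_lt hx hy)
    · intro a ha
      rw [norm_mul, hW a (Finset.mem_of_mem_erase ha), mul_one]
      exact hPa a (Finset.mem_of_mem_erase ha) (Finset.ne_of_mem_erase ha)
  rw [← norm_neg, ← eq_neg_of_add_eq_zero_left hsum, norm_mul, hW 0 h0mem, mul_one, hP0] at hrest
  exact lt_irrefl _ hrest
end
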